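/- Assume h(t,x,·) is convex on ℝ^m for every (t,x), and that the optimal control problem admits an optimal admissible pair (x*,u*), unique up to equality for Lebesgue-a.e. t. If (P) is feasible and (μ*, μ_T*, γ*, σ₊*, σ₋*, σ̂*) is a minimizer of (P), then γ* coincides with the occupation measure of x*: γ* equals the pushforward of Lebesgue measure on [0,T] under t ↦ (t, x*(t)). -/

import Mathlib

open MeasureTheory Set ProbabilityTheory

noncomputable section

/-- The input constraint set `U = [-1,1]^m`. -/
def Ubox (m : ℕ) : Set (Fin m → ℝ) := Set.Icc (fun _ => (-1 : ℝ)) (fun _ => (1 : ℝ))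

/-- The controlled vector field `F(t,x,u) = f(t,x) + g(t,x) u`. -/
def Fvec {n m : ℕ} (f : ℝ × (Fin n → ℝ) → Fin n → ℝ)
    (g : ℝ × (Fin n → ℝ) → Fin n → Fin m → ℝ)
    (z : ℝ × (Fin n → ℝ) × (Fin m → ℝ)) : Fin n → ℝ :=
  fun k => f (z.1, z.2.1) k + ∑ j, g (z.1, z.2.1) k j * z.2.2 j

/-- `(L_F v)(t,x,u) = ∂v/∂t + Σ_k (∂v/∂x_k)·[F(t,x,u)]_k`. -/
def LFop {n m : ℕ} (f : ℝ × (Fin n → ℝ) → Fin n → ℝ)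
    (g : ℝ × (Fin n → ℝ) → Fin n → Fin m → ℝ)
    (v : ℝ × (Fin n → ℝ) → ℝ) (z : ℝ × (Fin n → ℝ) × (Fin m → ℝ)) : ℝ :=
  fderiv ℝ v (z.1, z.2.1) ((1 : ℝ), (0 : Fin n → ℝ)) +
    ∑ k, fderiv ℝ v (z.1, z.2.1) ((0 : ℝ), Pi.single k (1 : ℝ)) * Fvec f g z k

/-- Liouville's equation for a pair of measures `(η, ηT)` with initial point `x₀`. -/
def SatisfiesLiouville {n m : ℕ} (T : ℝ) (x₀ : Fin n → ℝ)
    (f : ℝ × (Fin n → ℝ) → Fin n → ℝ) (g : ℝ × (Fin n → ℝ) → Fin n → Fin m → ℝ)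
    (η : Measure (ℝ × (Fin n → ℝ) × (Fin m → ℝ))) (ηT : Measure (Fin n → ℝ)) : Prop :=
  ∀ v : ℝ × (Fin n → ℝ) → ℝ, ContDiff ℝ 1 v →
    v (0, x₀) + ∫ z, LFop f g v z ∂η = ∫ y, v (T, y) ∂ηT

/-- An admissible pair: a Borel measurable control `u` with values in `U` and an
absolutely continuous trajectory `x` with `x(0) = x₀`, `x(T) ∈ X_T`, `x(t) ∈ X` on `[0,T]`
and `ẋ = F(t,x,u)` a.e. (encoded in integral form). -/
def IsAdmissiblePair {n m : ℕ} (T : ℝ) (X XT : Set (Fin n → ℝ)) (x₀ : Fin n → ℝ)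
    (f : ℝ × (Fin n → ℝ) → Fin n → ℝ) (g : ℝ × (Fin n → ℝ) → Fin n → Fin m → ℝ)
    (x : ℝ → Fin n → ℝ) (u : ℝ → Fin m → ℝ) : Prop :=
  Measurable u ∧ (∀ t ∈ Set.Icc (0 : ℝ) T, u t ∈ Ubox m) ∧
  x 0 = x₀ ∧ x T ∈ XT ∧ (∀ t ∈ Set.Icc (0 : ℝ) T, x t ∈ X) ∧
  IntegrableOn (fun s => Fvec f g (s, x s, u s)) (Set.Icc (0 : ℝ) T) volume ∧
  ∀ t ∈ Set.Icc (0 : ℝ) T, x t = x₀ + ∫ s in Set.Icc (0 : ℝ) t, Fvec f g (s, x s, u s)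

/-- The cost `J(x,u) = ∫₀^T h(t,x(t),u(t)) dt + H(x(T))` of an admissible pair. -/
def Jcost {n m : ℕ} (T : ℝ) (h : ℝ × (Fin n → ℝ) × (Fin m → ℝ) → ℝ)
    (H : (Fin n → ℝ) → ℝ) (x : ℝ → Fin n → ℝ) (u : ℝ → Fin m → ℝ) : ℝ :=
  (∫ t in Set.Icc (0 : ℝ) T, h (t, x t, u t)) + H (x T)

/-- The set of costs of admissible pairs; its infimum is `J*`. -/
def JVals {n m : ℕ} (T : ℝ) (X XT : Set (Fin n → ℝ)) (x₀ : Fin n → ℝ)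
    (f : ℝ × (Fin n → ℝ) → Fin n → ℝ) (g : ℝ × (Fin n → ℝ) → Fin n → Fin m → ℝ)
    (h : ℝ × (Fin n → ℝ) × (Fin m → ℝ) → ℝ) (H : (Fin n → ℝ) → ℝ) : Set ℝ :=
  {c | ∃ (x : ℝ → Fin n → ℝ) (u : ℝ → Fin m → ℝ),
    IsAdmissiblePair T X XT x₀ f g x u ∧ c = Jcost T h H x u}

/-- Feasibility for problem `(Q)`. -/
def QFeasible {n m : ℕ} (T : ℝ) (X XT : Set (Fin n → ℝ)) (x₀ : Fin n → ℝ)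
    (f : ℝ × (Fin n → ℝ) → Fin n → ℝ) (g : ℝ × (Fin n → ℝ) → Fin n → Fin m → ℝ)
    (η : Measure (ℝ × (Fin n → ℝ) × (Fin m → ℝ))) (ηT : Measure (Fin n → ℝ)) : Prop :=
  IsFiniteMeasure η ∧ IsFiniteMeasure ηT ∧
  η ((Set.Icc (0 : ℝ) T ×ˢ X ×ˢ Ubox m)ᶜ) = 0 ∧ ηT (XTᶜ) = 0 ∧
  SatisfiesLiouville T x₀ f g η ηT

/-- The cost `⟨η,h⟩ + ⟨η_T,H⟩` of a pair of measures. -/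
def Qcost {n m : ℕ} (h : ℝ × (Fin n → ℝ) × (Fin m → ℝ) → ℝ) (H : (Fin n → ℝ) → ℝ)
    (η : Measure (ℝ × (Fin n → ℝ) × (Fin m → ℝ))) (ηT : Measure (Fin n → ℝ)) : ℝ :=
  ∫ z, h z ∂η + ∫ y, H y ∂ηT

/-- The set of costs of feasible points of `(Q)`; its infimum is `q*`. -/
def QVals {n m : ℕ} (T : ℝ) (X XT : Set (Fin n → ℝ)) (x₀ : Fin n → ℝ)
    (f : ℝ × (Fin n → ℝ) → Fin n → ℝ) (g : ℝ × (Fin n → ℝ) → Fin n → Fin m → ℝ)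
    (h : ℝ × (Fin n → ℝ) × (Fin m → ℝ) → ℝ) (H : (Fin n → ℝ) → ℝ) : Set ℝ :=
  {c | ∃ (η : Measure (ℝ × (Fin n → ℝ) × (Fin m → ℝ))) (ηT : Measure (Fin n → ℝ)),
    QFeasible T X XT x₀ f g η ηT ∧ c = Qcost h H η ηT}

/-- `(L_f v)(t,x) = ∂v/∂t + Σ_k (∂v/∂x_k)·[f(t,x)]_k`. -/
def Lfop {n : ℕ} (f : ℝ × (Fin n → ℝ) → Fin n → ℝ)
    (v : ℝ × (Fin n → ℝ) → ℝ) (z : ℝ × (Fin n → ℝ)) : ℝ :=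
  fderiv ℝ v z ((1 : ℝ), (0 : Fin n → ℝ)) +
    ∑ k, fderiv ℝ v z ((0 : ℝ), Pi.single k (1 : ℝ)) * f z k

/-- `[L_g v]_j(t,x) = Σ_k (∂v/∂x_k)·g_{kj}(t,x)`. -/
def Lgop {n m : ℕ} (g : ℝ × (Fin n → ℝ) → Fin n → Fin m → ℝ)
    (v : ℝ × (Fin n → ℝ) → ℝ) (j : Fin m) (z : ℝ × (Fin n → ℝ)) : ℝ :=
  ∑ k, fderiv ℝ v z ((0 : ℝ), Pi.single k (1 : ℝ)) * g z k j

/-- Feasibility for the primal problem `(P)`. -/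
def PFeasible {n m : ℕ} (T : ℝ) (X XT : Set (Fin n → ℝ)) (x₀ : Fin n → ℝ)
    (f : ℝ × (Fin n → ℝ) → Fin n → ℝ) (g : ℝ × (Fin n → ℝ) → Fin n → Fin m → ℝ)
    (μ : Measure (ℝ × (Fin n → ℝ) × (Fin m → ℝ))) (μT : Measure (Fin n → ℝ))
    (γ : Measure (ℝ × (Fin n → ℝ))) (σp σm σh : Fin m → Measure (ℝ × (Fin n → ℝ))) : Prop :=
  IsFiniteMeasure μ ∧ IsFiniteMeasure μT ∧ IsFiniteMeasure γ ∧
  (∀ j, IsFiniteMeasure (σp j) ∧ IsFiniteMeasure (σm j) ∧ IsFiniteMeasure (σh j)) ∧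
  μ ((Set.Icc (0 : ℝ) T ×ˢ X ×ˢ Ubox m)ᶜ) = 0 ∧ μT (XTᶜ) = 0 ∧
  γ ((Set.Icc (0 : ℝ) T ×ˢ X)ᶜ) = 0 ∧
  (∀ j, σp j ((Set.Icc (0 : ℝ) T ×ˢ X)ᶜ) = 0 ∧ σm j ((Set.Icc (0 : ℝ) T ×ˢ X)ᶜ) = 0 ∧
    σh j ((Set.Icc (0 : ℝ) T ×ˢ X)ᶜ) = 0) ∧
  -- (a) Liouville's equation
  SatisfiesLiouville T x₀ f g μ μT ∧
  -- (b) ∫ L_F v dμ = ∫ L_f v dγ + Σ_j ∫ [L_g v]_j d([σ₊]_j − [σ₋]_j)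
  (∀ v : ℝ × (Fin n → ℝ) → ℝ, ContDiff ℝ 1 v →
    ∫ z, LFop f g v z ∂μ =
      ∫ z, Lfop f v z ∂γ +
        ∑ j, (∫ z, Lgop g v j z ∂(σp j) - ∫ z, Lgop g v j z ∂(σm j))) ∧
  -- (c) [σ₊]_j + [σ₋]_j + [σ̂]_j = γ
  (∀ j, σp j + σm j + σh j = γ) ∧
  -- (d) γ is the (t,x)-marginal of μ
  γ = μ.map (fun z => (z.1, z.2.1))

/-- The set of costs of feasible points of `(P)`; its infimum is `p*`. -/
def PVals {n m : ℕ} (T : ℝ) (X XT : Set (Fin n → ℝ)) (x₀ : Fin n → ℝ)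
    (f : ℝ × (Fin n → ℝ) → Fin n → ℝ) (g : ℝ × (Fin n → ℝ) → Fin n → Fin m → ℝ)
    (h : ℝ × (Fin n → ℝ) × (Fin m → ℝ) → ℝ) (H : (Fin n → ℝ) → ℝ) : Set ℝ :=
  {c | ∃ (μ : Measure (ℝ × (Fin n → ℝ) × (Fin m → ℝ))) (μT : Measure (Fin n → ℝ))
    (γ : Measure (ℝ × (Fin n → ℝ))) (σp σm σh : Fin m → Measure (ℝ × (Fin n → ℝ))),
    PFeasible T X XT x₀ f g μ μT γ σp σm σh ∧ c = Qcost h H μ μT}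


/-- Approximate trajectories: piecewise linear curves whose velocities are sampled at
`ε`-close points of the constraint set `K`. -/
inductive Chain {n m : ℕ} (K : Set (ℝ × (Fin n → ℝ) × (Fin m → ℝ))) (XT : Set (Fin n → ℝ))
    (G : ℝ × (Fin n → ℝ) × (Fin m → ℝ) → Fin n → ℝ)
    (h : ℝ × (Fin n → ℝ) × (Fin m → ℝ) → ℝ) (H : (Fin n → ℝ) → ℝ) (T ε : ℝ) :
    ℝ × (Fin n → ℝ) → ℝ → Prop
  | term (p : ℝ × (Fin n → ℝ)) (y : Fin n → ℝ) (hy : y ∈ XT) (hp : dist p (T, y) < ε) :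
      Chain K XT G h H T ε p (H y)
  | step (p : ℝ × (Fin n → ℝ)) (θ : ℝ × (Fin n → ℝ) × (Fin m → ℝ)) (τ c : ℝ) (hθ : θ ∈ K)
      (hτ : 0 < τ) (hτε : τ < ε) (hp : dist p (θ.1, θ.2.1) < ε)
      (hc : Chain K XT G h H T ε (p + τ • ((1 : ℝ), G θ)) c) :
      Chain K XT G h H T ε p (c + τ * h θ)

section chains
variable {n m : ℕ} {K : Set (ℝ × (Fin n → ℝ) × (Fin m → ℝ))} {XT : Set (Fin n → ℝ)}
    {G : ℝ × (Fin n → ℝ) × (Fin m → ℝ) → Fin n → ℝ}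
    {h : ℝ × (Fin n → ℝ) × (Fin m → ℝ) → ℝ} {H : (Fin n → ℝ) → ℝ} {T ε : ℝ}

lemma chain_open {p : ℝ × (Fin n → ℝ)} {c : ℝ} (hc : Chain K XT G h H T ε p c) :
    ∃ r > 0, ∀ q, dist q p < r → Chain K XT G h H T ε q c := by
  induction hc with
  | term p y hy hp =>
    refine ⟨ε - dist p (T, y), by linarith, fun q hq => Chain.term q y hy ?_⟩
    linarith [dist_triangle q p (T, y)]
  | step p θ τ c hθ hτ hτε hp hc ih =>
    obtain ⟨r, hr, ih⟩ := ih
    refine ⟨min r (ε - dist p (θ.1, θ.2.1)), lt_min hr (by linarith), fun q hq => ?_⟩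
    refine Chain.step q θ τ c hθ hτ hτε ?_ (ih _ ?_)
    · linarith [dist_triangle q p (θ.1, θ.2.1), lt_of_lt_of_le hq (min_le_right _ _)]
    · rw [dist_add_right]
      exact lt_of_lt_of_le hq (min_le_left _ _)

lemma chain_lower {C D : ℝ} (hC : ∀ θ ∈ K, |h θ| ≤ C) (hC0 : 0 ≤ C) (hD : ∀ y ∈ XT, |H y| ≤ D)
    {p : ℝ × (Fin n → ℝ)} {c : ℝ} (hc : Chain K XT G h H T ε p c) :
    - D - C * (T + ε - p.1) ≤ c := by
  induction hc with
  | term p y hy hp =>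
    have h1 : dist p.1 T < ε := lt_of_le_of_lt (le_max_left _ _) hp
    rw [Real.dist_eq] at h1
    have h2 := (abs_lt.1 h1).2
    have h3 := (abs_le.1 (hD y hy)).1
    nlinarith
  | step p θ τ c hθ hτ hτε hp hc ih =>
    have h3 := (abs_le.1 (hC θ hθ)).1
    simp only [Prod.fst_add, Prod.smul_fst, smul_eq_mul, mul_one] at ih
    nlinarith

lemma integrable_of_cont {Z : Type*} [TopologicalSpace Z] [T2Space Z] [MeasurableSpace Z] [BorelSpace Z]
    [SecondCountableTopology Z] {K : Set Z} (hK : IsCompact K) (μ : Measure Z) [IsFiniteMeasure μ]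
    (hμ : μ Kᶜ = 0) {φ : Z → ℝ} (hφ : Continuous φ) : Integrable φ μ := by
  obtain ⟨C, hC⟩ := hK.exists_bound_of_continuousOn hφ.continuousOn
  refine Integrable.of_bound hφ.aestronglyMeasurable C ?_
  have : ∀ᵐ z ∂μ, z ∈ K := hμ
  filter_upwards [this] with z hz using hC z hz

/-- The value function of the approximate problem, capped. -/
def Vfun (K : Set (ℝ × (Fin n → ℝ) × (Fin m → ℝ))) (XT : Set (Fin n → ℝ))
    (G : ℝ × (Fin n → ℝ) × (Fin m → ℝ) → Fin n → ℝ)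
    (h : ℝ × (Fin n → ℝ) × (Fin m → ℝ) → ℝ) (H : (Fin n → ℝ) → ℝ) (T ε C M : ℝ)
    (p : ℝ × (Fin n → ℝ)) : ℝ :=
  sInf (insert (M + C * p.1) {c | Chain K XT G h H T ε p c})

lemma V_bdd {C D M : ℝ} (hC : ∀ θ ∈ K, |h θ| ≤ C) (hC0 : 0 ≤ C) (hD : ∀ y ∈ XT, |H y| ≤ D)
    (p : ℝ × (Fin n → ℝ)) :
    BddBelow (insert (M + C * p.1) {c | Chain K XT G h H T ε p c}) := by
  apply BddBelow.insert
  exact ⟨_, fun c hc => chain_lower hC hC0 hD hc⟩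

lemma V_step {C D M : ℝ} (hC : ∀ θ ∈ K, |h θ| ≤ C) (hC0 : 0 ≤ C) (hD : ∀ y ∈ XT, |H y| ≤ D)
    (p : ℝ × (Fin n → ℝ)) (θ : ℝ × (Fin n → ℝ) × (Fin m → ℝ)) (τ : ℝ) (hθ : θ ∈ K)
      (hτ : 0 < τ) (hτε : τ < ε) (hp : dist p (θ.1, θ.2.1) < ε) :
    Vfun K XT G h H T ε C M p ≤ Vfun K XT G h H T ε C M (p + τ • ((1 : ℝ), G θ)) + τ * h θ := by
  rw [← sub_le_iff_le_add]
  refine le_csInf ⟨_, mem_insert _ _⟩ ?_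
  rintro c (rfl | hc)
  · rw [sub_le_iff_le_add]
    refine (csInf_le (V_bdd hC hC0 hD p) (mem_insert _ _)).trans ?_
    have h3 := (abs_le.1 (hC θ hθ)).1
    simp only [Prod.fst_add, Prod.smul_fst, smul_eq_mul, mul_one]
    nlinarith
  · rw [sub_le_iff_le_add]
    exact csInf_le (V_bdd hC hC0 hD p) (Or.inr (Chain.step p θ τ c hθ hτ hτε hp hc))

lemma V_meas {C D M : ℝ} (hC : ∀ θ ∈ K, |h θ| ≤ C) (hC0 : 0 ≤ C) (hD : ∀ y ∈ XT, |H y| ≤ D) :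
    Measurable (Vfun K XT G h H T ε C M) := by
  refine measurable_of_Iio fun c => ?_
  have : Vfun K XT G h H T ε C M ⁻¹' Iio c =
      {p | M + C * p.1 < c} ∪ {p | ∃ c' < c, Chain K XT G h H T ε p c'} := by
    ext p
    simp only [mem_preimage, mem_Iio, mem_union, mem_ofPred_eq, Vfun]
    rw [csInf_lt_iff (V_bdd hC hC0 hD p) ⟨_, mem_insert _ _⟩]
    simp only [mem_insert_iff, mem_ofPred_eq]
    constructor
    · rintro ⟨b, rfl | hb, hbc⟩
      · exact Or.inl hbc
      · exact Or.inr ⟨b, hbc, hb⟩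
    · rintro (hb | ⟨b, hbc, hb⟩)
      · exact ⟨_, Or.inl rfl, hb⟩
      · exact ⟨b, Or.inr hb, hbc⟩
  rw [this]
  refine (IsOpen.union ?_ ?_).measurableSet
  · exact isOpen_lt (by fun_prop) continuous_const
  · rw [Metric.isOpen_iff]
    rintro p ⟨c', hc', hp⟩
    obtain ⟨r, hr, hr'⟩ := chain_open hp
    exact ⟨r, hr, fun q hq => ⟨c', hc', hr' q hq⟩⟩

lemma V_bounds {C D M : ℝ} (hC : ∀ θ ∈ K, |h θ| ≤ C) (hC0 : 0 ≤ C) (hD : ∀ y ∈ XT, |H y| ≤ D)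
    (p : ℝ × (Fin n → ℝ)) :
    min (M + C * p.1) (- D - C * (T + ε - p.1)) ≤ Vfun K XT G h H T ε C M p ∧
    Vfun K XT G h H T ε C M p ≤ M + C * p.1 := by
  constructor
  · refine le_csInf ⟨_, mem_insert _ _⟩ ?_
    rintro c (rfl | hc)
    · exact min_le_left _ _
    · exact (min_le_right _ _).trans (chain_lower hC hC0 hD hc)
  · exact csInf_le (V_bdd hC hC0 hD p) (mem_insert _ _)

lemma V_locInt {C D M : ℝ} (hC : ∀ θ ∈ K, |h θ| ≤ C) (hC0 : 0 ≤ C) (hD : ∀ y ∈ XT, |H y| ≤ D) :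
    LocallyIntegrable (Vfun K XT G h H T ε C M) volume := by
  have hcont : Continuous (fun p : ℝ × (Fin n → ℝ) =>
      |min (M + C * p.1) (- D - C * (T + ε - p.1))| + |M + C * p.1|) := by fun_prop
  refine hcont.locallyIntegrable.mono (V_meas hC hC0 hD).aestronglyMeasurable ?_
  refine Filter.Eventually.of_forall fun p => ?_
  obtain ⟨h1, h2⟩ := V_bounds (G := G) (T := T) (ε := ε) (M := M) hC hC0 hD p
  rw [Real.norm_eq_abs, Real.norm_eq_abs]
  refine le_trans ?_ (le_abs_self _)
  rw [abs_le]
  constructor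
  · linarith [neg_abs_le (min (M + C * p.1) (- D - C * (T + ε - p.1))), abs_nonneg (M + C * p.1)]
  · linarith [le_abs_self (M + C * p.1), abs_nonneg (min (M + C * p.1) (- D - C * (T + ε - p.1)))]

lemma chain_exists (hK : IsCompact K) (hXT : IsCompact XT) (hG : Continuous G) (hh : Continuous h)
    (hH : Continuous H) (x₀ : Fin n → ℝ)
    (μ : Measure (ℝ × (Fin n → ℝ) × (Fin m → ℝ))) (μT : Measure (Fin n → ℝ))
    [IsFiniteMeasure μ] [IsFiniteMeasure μT] (hμ : μ Kᶜ = 0) (hμT : μT XTᶜ = 0)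
    (hL : ∀ v : ℝ × (Fin n → ℝ) → ℝ, ContDiff ℝ 1 v →
      v (0, x₀) + ∫ z, fderiv ℝ v (z.1, z.2.1) ((1 : ℝ), G z) ∂μ = ∫ y, v (T, y) ∂μT)
    (hε : 0 < ε) :
    ∃ p c, Chain K XT G h H T ε p c ∧ dist p (0, x₀) < ε ∧
      c < ∫ z, h z ∂μ + ∫ y, H y ∂μT + ε := by
  by_contra hcon
  push Not at hcon
  have : (volume : Measure (ℝ × (Fin n → ℝ))).IsAddHaarMeasure :=
    Measure.prod.instIsAddHaarMeasure volume volume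
  obtain ⟨C', hC'⟩ := hK.exists_bound_of_continuousOn hh.continuousOn
  obtain ⟨D, hD⟩ := hXT.exists_bound_of_continuousOn hH.continuousOn
  obtain ⟨C, hC, hC0⟩ : ∃ C, (∀ θ ∈ K, |h θ| ≤ C) ∧ 0 ≤ C :=
    ⟨max C' 0, fun θ hθ => (hC' θ hθ).trans (le_max_left _ _), le_max_right _ _⟩
  set Q := ∫ z, h z ∂μ + ∫ y, H y ∂μT with hQ
  set M := Q + ε + C * ε with hM
  set V := Vfun K XT G h H T ε C M with hV
  let b : ContDiffBump (0 : ℝ × (Fin n → ℝ)) := ⟨ε / 2, ε, by linarith, by linarith⟩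
  set ρ := b.normed volume with hρ
  have hρ0 : ∀ q, 0 ≤ ρ q := fun q => b.nonneg_normed q
  have hρs : ∀ q, ρ q ≠ 0 → ‖q‖ < ε := by
    intro q hq
    have : q ∈ Function.support ρ := hq
    rw [hρ, b.support_normed_eq] at this
    simpa using this
  have hρi : ∫ q, ρ q = 1 := b.integral_normed
  have hVl : LocallyIntegrable V volume := V_locInt hC hC0 hD
  set v : ℝ × (Fin n → ℝ) → ℝ := convolution ρ V (ContinuousLinearMap.lsmul ℝ ℝ) volume with hv
  have hvC : ContDiff ℝ 1 v :=
    b.hasCompactSupport_normed.contDiff_convolution_left (n := 1) _ b.contDiff_normed hVl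
  have hex : ConvolutionExists ρ V (ContinuousLinearMap.lsmul ℝ ℝ) volume :=
    b.hasCompactSupport_normed.convolutionExists_left _ b.continuous_normed hVl
  have hIntg : ∀ p, Integrable (fun q => ρ q * V (p - q)) volume := by
    intro p
    simpa [ConvolutionExistsAt] using hex p
  have hvdef : ∀ p, v p = ∫ q, ρ q * V (p - q) := by
    intro p
    simp [hv, convolution_def]
  have hρint : Integrable ρ volume := b.integrable_normed
  -- step inequality
  have hstep : ∀ θ ∈ K, ∀ τ, 0 < τ → τ < ε →
      v (θ.1, θ.2.1) ≤ v ((θ.1, θ.2.1) + τ • ((1 : ℝ), G θ)) + τ * h θ := by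
    intro θ hθ τ hτ hτε
    have e : v ((θ.1, θ.2.1) + τ • ((1 : ℝ), G θ)) + τ * h θ =
        ∫ q, (ρ q * V ((θ.1, θ.2.1) + τ • ((1 : ℝ), G θ) - q) + ρ q * (τ * h θ)) := by
      rw [integral_add (hIntg _) (hρint.mul_const _), integral_mul_const, hρi, hvdef, one_mul]
    rw [e, hvdef]
    refine integral_mono (hIntg _) ((hIntg _).add (hρint.mul_const _)) fun q => ?_
    simp only
    rw [← mul_add]
    by_cases hq : ρ q = 0
    · simp [hq]
    · refine mul_le_mul_of_nonneg_left ?_ (hρ0 q)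
      have := V_step (G := G) (T := T) (M := M) hC hC0 hD ((θ.1, θ.2.1) - q) θ τ hθ hτ hτε (by
        rw [dist_eq_norm]; simpa using hρs q hq)
      rw [sub_add_eq_add_sub] at this
      exact this
  have hder : ∀ θ ∈ K, 0 ≤ fderiv ℝ v (θ.1, θ.2.1) ((1 : ℝ), G θ) + h θ := by
    intro θ hθ
    have hd : HasDerivAt (fun τ : ℝ => v ((θ.1, θ.2.1) + τ • ((1 : ℝ), G θ)) + τ * h θ)
        (fderiv ℝ v (θ.1, θ.2.1) ((1 : ℝ), G θ) + h θ) 0 := by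
      have h1 : HasFDerivAt v (fderiv ℝ v (θ.1, θ.2.1))
          ((θ.1, θ.2.1) + (0 : ℝ) • ((1 : ℝ), G θ)) := by
        rw [zero_smul, add_zero]
        exact (hvC.differentiable one_ne_zero _).hasFDerivAt
      have h2 : HasDerivAt (fun τ : ℝ => (θ.1, θ.2.1) + τ • ((1 : ℝ), G θ)) ((1 : ℝ), G θ) 0 := by
        simpa using ((hasDerivAt_id (0 : ℝ)).smul_const ((1 : ℝ), G θ)).const_add (θ.1, θ.2.1)
      have h3 := h1.comp_hasDerivAt (0 : ℝ) h2
      have h4 : HasDerivAt (fun τ : ℝ => τ * h θ) (h θ) 0 := by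
        simpa using (hasDerivAt_id (0 : ℝ)).mul_const (h θ)
      exact h3.add h4
    have hs := hd.hasDerivWithinAt (s := Ioi 0)
    rw [hasDerivWithinAt_iff_tendsto_slope' (by simp)] at hs
    refine ge_of_tendsto hs ?_
    filter_upwards [Ioo_mem_nhdsGT hε] with τ hτ
    rw [slope_def_field]
    refine div_nonneg ?_ (by linarith [hτ.1])
    have := hstep θ hθ τ hτ.1 hτ.2
    simp only [zero_smul, add_zero, zero_mul]
    linarith
  have hterm : ∀ y ∈ XT, v (T, y) ≤ H y := by
    intro y hy
    have e : H y = ∫ q, ρ q * H y := by rw [integral_mul_const, hρi, one_mul]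
    rw [e, hvdef]
    refine integral_mono (hIntg _) (hρint.mul_const _) fun q => ?_
    by_cases hq : ρ q = 0
    · simp [hq]
    · refine mul_le_mul_of_nonneg_left ?_ (hρ0 q)
      refine csInf_le (V_bdd hC hC0 hD _) (Or.inr (Chain.term _ y hy ?_))
      rw [dist_eq_norm]; simpa using hρs q hq
  have hinit : Q + ε ≤ v (0, x₀) := by
    have e : Q + ε = ∫ q, ρ q * (Q + ε) := by rw [integral_mul_const, hρi, one_mul]
    rw [e, hvdef]
    refine integral_mono (hρint.mul_const _) (hIntg _) fun q => ?_
    by_cases hq : ρ q = 0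
    · simp [hq]
    · refine mul_le_mul_of_nonneg_left ?_ (hρ0 q)
      have hq' := hρs q hq
      refine le_csInf ⟨_, mem_insert _ _⟩ ?_
      rintro c (rfl | hc)
      · have : |q.1| < ε := lt_of_le_of_lt (norm_fst_le q) hq'
        have := (abs_lt.1 this).2
        simp only [Prod.fst_sub, zero_sub]
        nlinarith
      · refine hcon _ c hc ?_
        rw [dist_eq_norm]; simpa using hq'
  have hLv := hL v hvC
  have hc1 : Continuous (fun z : ℝ × (Fin n → ℝ) × (Fin m → ℝ) =>
      fderiv ℝ v (z.1, z.2.1) ((1 : ℝ), G z)) :=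
    ((hvC.continuous_fderiv one_ne_zero).comp (by fun_prop)).clm_apply (by fun_prop)
  have hi1 := integrable_of_cont hK μ hμ hc1
  have hi2 := integrable_of_cont hK μ hμ hh
  have hi3 := integrable_of_cont hXT μT hμT hH
  have hi4 := integrable_of_cont hXT μT hμT (φ := fun y => v (T, y)) (hvC.continuous.comp (by fun_prop))
  have hge : 0 ≤ ∫ z, (fderiv ℝ v (z.1, z.2.1) ((1 : ℝ), G z) + h z) ∂μ := by
    refine integral_nonneg_of_ae ?_
    have : ∀ᵐ z ∂μ, z ∈ K := hμ
    filter_upwards [this] with z hz using hder z hz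
  rw [integral_add hi1 hi2] at hge
  have hle : ∫ y, v (T, y) ∂μT ≤ ∫ y, H y ∂μT := by
    refine integral_mono_ae hi4 hi3 ?_
    have : ∀ᵐ z ∂μT, z ∈ XT := hμT
    filter_upwards [this] with z hz using hterm z hz
  linarith

end chains

open Filter Topology in
lemma ultra_lim {V : Type*} [NormedAddCommGroup V] [ProperSpace V] (l : Ultrafilter ℕ) (w : ℕ → V) (R : ℝ)
    (hw : ∀ k, ‖w k‖ ≤ R) : ∃ y, Tendsto w l (𝓝 y) := by
  have hc := isCompact_closedBall (0 : V) R
  obtain ⟨y, -, hy⟩ := hc.ultrafilter_le_nhds (l.map w) (by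
    rw [le_principal_iff]
    exact Filter.mem_map.2 (Filter.Eventually.of_forall fun k => by simpa using hw k))
  exact ⟨y, hy⟩

section bddmeas
variable {n m : ℕ} {K : Set (ℝ × (Fin n → ℝ) × (Fin m → ℝ))}
  {V : Type*} [NormedAddCommGroup V] [NormedSpace ℝ V] [FiniteDimensional ℝ V]

lemma ii_comp (hK : IsCompact K) {φ : ℝ × (Fin n → ℝ) × (Fin m → ℝ) → V} (hφ : Continuous φ)
    {θ : ℝ → ℝ × (Fin n → ℝ) × (Fin m → ℝ)} (hθ : Measurable θ) (hθK : ∀ s, θ s ∈ K) (a b : ℝ) :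
    IntervalIntegrable (fun s => φ (θ s)) volume a b := by
  obtain ⟨C, hC⟩ := hK.exists_bound_of_continuousOn hφ.continuousOn
  have hm : StronglyMeasurable (fun s => φ (θ s)) := hφ.stronglyMeasurable.comp_measurable hθ
  constructor <;>
  exact IntegrableOn.of_bound (by simp) hm.aestronglyMeasurable C
    (Filter.Eventually.of_forall fun s => hC _ (hθK s))

lemma concat_left {φ : ℝ × (Fin n → ℝ) × (Fin m → ℝ) → V}
    (θ₀ : ℝ × (Fin n → ℝ) × (Fin m → ℝ))
    (θ : ℝ → ℝ × (Fin n → ℝ) × (Fin m → ℝ)) {a b s : ℝ} (has : a ≤ s) (hsb : s ≤ b) :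
    ∫ r in a..s, φ (if r < b then θ₀ else θ r) = (s - a) • φ θ₀ := by
  have : ∫ r in a..s, φ (if r < b then θ₀ else θ r) = ∫ r in a..s, φ θ₀ := by
    refine intervalIntegral.integral_congr_ae ?_
    have hne : ∀ᵐ r : ℝ, r ≠ b := by simp [ae_iff]
    filter_upwards [hne] with r hr hr'
    rw [uIoc_of_le has] at hr'
    rw [if_pos (lt_of_le_of_ne (hr'.2.trans hsb) hr)]
  rw [this, intervalIntegral.integral_const]

lemma concat_right (hK : IsCompact K) {φ : ℝ × (Fin n → ℝ) × (Fin m → ℝ) → V} (hφ : Continuous φ)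
    {θ₀ : ℝ × (Fin n → ℝ) × (Fin m → ℝ)} (hθ₀ : θ₀ ∈ K)
    {θ : ℝ → ℝ × (Fin n → ℝ) × (Fin m → ℝ)} (hθ : Measurable θ) (hθK : ∀ s, θ s ∈ K)
    {a b s : ℝ} (hab : a ≤ b) (hbs : b ≤ s) :
    ∫ r in a..s, φ (if r < b then θ₀ else θ r) = (b - a) • φ θ₀ + ∫ r in b..s, φ (θ r) := by
  have hm : Measurable (fun r => if r < b then θ₀ else θ r) :=
    Measurable.ite measurableSet_Iio measurable_const hθ
  have hmK : ∀ r, (if r < b then θ₀ else θ r) ∈ K := by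
    intro r; split_ifs
    · exact hθ₀
    · exact hθK r
  rw [← intervalIntegral.integral_add_adjacent_intervals (b := b) (ii_comp hK hφ hm hmK _ _)
    (ii_comp hK hφ hm hmK _ _), concat_left θ₀ θ hab le_rfl]
  congr 1
  refine intervalIntegral.integral_congr fun r hr => ?_
  rw [uIcc_of_le hbs] at hr
  rw [if_neg (not_lt.2 hr.1)]

end bddmeas

section conv
variable {n m : ℕ} {K : Set (ℝ × (Fin n → ℝ) × (Fin m → ℝ))} {XT : Set (Fin n → ℝ)}
    {G : ℝ × (Fin n → ℝ) × (Fin m → ℝ) → Fin n → ℝ}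
    {h : ℝ × (Fin n → ℝ) × (Fin m → ℝ) → ℝ} {H : (Fin n → ℝ) → ℝ} {T ε : ℝ}

lemma chain_fun (hK : IsCompact K) (hG : Continuous G) (hh : Continuous h)
    {B : ℝ} (hB : ∀ z ∈ K, ‖G z‖ ≤ B) (hne : K.Nonempty) (hε : 0 < ε)
    {p : ℝ × (Fin n → ℝ)} {c : ℝ} (hc : Chain K XT G h H T ε p c) :
    ∃ (t₁ : ℝ) (y : Fin n → ℝ) (θ : ℝ → ℝ × (Fin n → ℝ) × (Fin m → ℝ)),
      p.1 ≤ t₁ ∧ |t₁ - T| < ε ∧ y ∈ XT ∧ Measurable θ ∧ (∀ s, θ s ∈ K) ∧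
      dist (p.2 + ∫ s in p.1..t₁, G (θ s)) y < ε ∧ c = (∫ s in p.1..t₁, h (θ s)) + H y ∧
      ∀ s ∈ Ico p.1 t₁, dist (θ s).1 s ≤ 2 * ε ∧
        dist (θ s).2.1 (p.2 + ∫ r in p.1..s, G (θ r)) ≤ (1 + B) * ε := by
  induction hc with
  | term p y hy hp =>
    obtain ⟨θ₀, hθ₀⟩ := hne
    have h1 : dist p.1 T < ε := lt_of_le_of_lt (le_max_left _ _) hp
    have h2 : dist p.2 y < ε := lt_of_le_of_lt (le_max_right _ _) hp
    refine ⟨p.1, y, fun _ => θ₀, le_rfl, h1, hy, measurable_const, fun _ => hθ₀, ?_, ?_, ?_⟩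
    · simpa using h2
    · simp
    · simp
  | step p θ₀ τ c hθ hτ hτε hp hc ih =>
    obtain ⟨t₁, y, θ, h1, h2, h3, h4, h5, h6, h7, h8⟩ := ih
    simp only [Prod.fst_add, Prod.snd_add, Prod.smul_fst, Prod.smul_snd, smul_eq_mul, mul_one]
      at h1 h6 h7 h8
    have hm : Measurable (fun r => if r < p.1 + τ then θ₀ else θ r) :=
      Measurable.ite measurableSet_Iio measurable_const h4
    have hmK : ∀ r, (if r < p.1 + τ then θ₀ else θ r) ∈ K := by
      intro r; split_ifs
      · exact hθ
      · exact h5 r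
    have e1 : dist p.1 θ₀.1 < ε := lt_of_le_of_lt (le_max_left _ _) hp
    have e2 : dist p.2 θ₀.2.1 < ε := lt_of_le_of_lt (le_max_right _ _) hp
    have hpτ : p.1 ≤ p.1 + τ := by linarith
    refine ⟨t₁, y, fun r => if r < p.1 + τ then θ₀ else θ r, hpτ.trans h1, h2, h3, hm, hmK,
      ?_, ?_, ?_⟩
    · rw [concat_right hK hG hθ h4 h5 hpτ h1, ← add_assoc]
      simpa using h6
    · rw [concat_right hK hh hθ h4 h5 hpτ h1, h7, smul_eq_mul]
      ring
    · intro s hs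
      beta_reduce
      by_cases hsb : s < p.1 + τ
      · rw [concat_left θ₀ θ hs.1 hsb.le, if_pos hsb]
        constructor
        · rw [Real.dist_eq] at e1 ⊢
          rw [abs_lt] at e1
          rw [abs_le]
          constructor <;> linarith [hs.1]
        · rw [dist_eq_norm] at e2 ⊢
          have : θ₀.2.1 - (p.2 + (s - p.1) • G θ₀) = -(p.2 - θ₀.2.1) - (s - p.1) • G θ₀ := by abel
          rw [this]
          refine (norm_sub_le _ _).trans ?_
          rw [norm_neg, norm_smul, Real.norm_eq_abs, abs_of_nonneg (by linarith [hs.1])]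
          have : (s - p.1) * ‖G θ₀‖ ≤ ε * B :=
            mul_le_mul (by linarith) (hB _ hθ) (norm_nonneg _) hε.le
          linarith
      · push Not at hsb
        rw [concat_right hK hG hθ h4 h5 hpτ hsb, if_neg (not_lt.2 hsb)]
        have := h8 s ⟨hsb, hs.2⟩
        refine ⟨this.1, ?_⟩
        rw [← add_assoc]
        simpa using this.2

end conv

section closure
open Filter Topology
variable {n m : ℕ} {X XT : Set (Fin n → ℝ)} {K : Set (ℝ × (Fin n → ℝ) × (Fin m → ℝ))}
    {G : ℝ × (Fin n → ℝ) × (Fin m → ℝ) → Fin n → ℝ} {T : ℝ}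

lemma norm_II_le {V : Type*} [NormedAddCommGroup V] [NormedSpace ℝ V]
    {φ : ℝ × (Fin n → ℝ) × (Fin m → ℝ) → V} {θ : ℝ → ℝ × (Fin n → ℝ) × (Fin m → ℝ)}
    (hθK : ∀ s, θ s ∈ K) {C : ℝ} (hC : ∀ z ∈ K, ‖φ z‖ ≤ C) (a b : ℝ) :
    ‖∫ s in a..b, φ (θ s)‖ ≤ C * |b - a| :=
  intervalIntegral.norm_integral_le_of_norm_le_const fun s _ => hC _ (hθK s)

/-- pointwise ultralimits of primitives -/
lemma limfun (hK : IsCompact K) {V : Type*} [NormedAddCommGroup V] [NormedSpace ℝ V]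
    [FiniteDimensional ℝ V] (l : Ultrafilter ℕ) {θ : ℕ → ℝ → ℝ × (Fin n → ℝ) × (Fin m → ℝ)}
    (hθ : ∀ k, Measurable (θ k)) (hθK : ∀ k s, θ k s ∈ K)
    {φ : ℝ × (Fin n → ℝ) × (Fin m → ℝ) → V} (hφ : Continuous φ) {C : NNReal}
    (hC : ∀ z ∈ K, ‖φ z‖ ≤ C) :
    ∃ Y : ℝ → V, (∀ t, Tendsto (fun k => ∫ s in (0 : ℝ)..t, φ (θ k s)) l (𝓝 (Y t))) ∧
      LipschitzWith C Y := by
  have : ProperSpace V := FiniteDimensional.proper ℝ V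
  have hex : ∀ t, ∃ y, Tendsto (fun k => ∫ s in (0 : ℝ)..t, φ (θ k s)) l (𝓝 y) := fun t =>
    ultra_lim l _ _ fun k => norm_II_le (hθK k) hC 0 t
  choose Y hY using hex
  refine ⟨Y, hY, LipschitzWith.of_dist_le_mul fun a b => ?_⟩
  refine le_of_tendsto ((hY a).dist (hY b)) (Eventually.of_forall fun k => ?_)
  rw [dist_eq_norm, intervalIntegral.integral_interval_sub_left (ii_comp hK hφ (hθ k) (hθK k) _ _)
    (ii_comp hK hφ (hθ k) (hθK k) _ _), Real.dist_eq]
  exact norm_II_le (hθK k) hC b a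

lemma key_jensen (hK : IsCompact (Icc (0 : ℝ) T ×ˢ X ×ˢ Ubox m))
    (l : Ultrafilter ℕ) {θ : ℕ → ℝ → ℝ × (Fin n → ℝ) × (Fin m → ℝ)}
    (hθ : ∀ k, Measurable (θ k)) (hθK : ∀ k s, θ k s ∈ Icc (0 : ℝ) T ×ˢ X ×ˢ Ubox m)
    (y : ℕ → ℝ → Fin n → ℝ) {B : NNReal} (hy : ∀ k, LipschitzWith B (y k))
    (x : ℝ → Fin n → ℝ) (hx : ∀ t, Tendsto (fun k => y k t) l (𝓝 (x t)))
    (htr : ∀ δ > 0, ∀ᶠ k in (l : Filter ℕ), ∀ s ∈ Ioo δ (T - δ),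
      dist (θ k s).1 s ≤ δ ∧ dist (θ k s).2.1 (y k s) ≤ δ)
    (Yu : Fin m → ℝ → ℝ)
    (hYu : ∀ j t, Tendsto (fun k => ∫ s in (0 : ℝ)..t, (θ k s).2.2 j) l (𝓝 (Yu j t)))
    {φ : ℝ × (Fin n → ℝ) × (Fin m → ℝ) → ℝ} (hφ : Continuous φ)
    (hconv : ∀ t x, ConvexOn ℝ univ (fun u => φ (t, x, u)))
    (Y : ℝ → ℝ) (hY : ∀ t, Tendsto (fun k => ∫ s in (0 : ℝ)..t, φ (θ k s)) l (𝓝 (Y t)))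
    {t : ℝ} (ht : t ∈ Ioo 0 T) (hxX : x t ∈ X) (hdY : DifferentiableAt ℝ Y t)
    (hdu : ∀ j, DifferentiableAt ℝ (Yu j) t) :
    φ (t, x t, fun j => deriv (Yu j) t) ≤ deriv Y t := by
  refine le_of_forall_pos_le_add fun η hη => ?_
  have huc := hK.uniformContinuousOn_of_continuous hφ.continuousOn
  rw [Metric.uniformContinuousOn_iff] at huc
  obtain ⟨r, hr, huc⟩ := huc η hη
  have ht1 := ht.1
  have ht2 := ht.2
  have hB1 : (0 : ℝ) < B + 1 := by positivity
  set δ := min (r / 4) (min (t / 2) ((T - t) / 4)) with hδ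
  have hδ0 : 0 < δ := lt_min (by linarith) (lt_min (by linarith) (by linarith))
  have hδ1 : δ ≤ r / 4 := min_le_left _ _
  have hδ2 : δ ≤ t / 2 := (min_le_right _ _).trans (min_le_left _ _)
  have hδ3 : δ ≤ (T - t) / 4 := (min_le_right _ _).trans (min_le_right _ _)
  set τ₀ := min ((T - t) / 4) (r / 4 / (B + 1)) with hτ₀
  have hτ₀0 : 0 < τ₀ := lt_min (by linarith) (by positivity)
  -- slope inequality
  have hslope : ∀ b ∈ Ioo t (t + τ₀),
      φ (t, x t, fun j => slope (Yu j) t b) ≤ slope Y t b + η := by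
    intro b hb
    have hbt : 0 < b - t := by linarith [hb.1]
    have hb1 : b - t < (T - t) / 4 := by
      have := min_le_left ((T - t) / 4) (r / 4 / (B + 1)); linarith [hb.2]
    have hb2 : (B + 1) * (b - t) ≤ r / 4 := by
      have : b - t ≤ r / 4 / (B + 1) := by
        have := min_le_right ((T - t) / 4) (r / 4 / (B + 1)); linarith [hb.2]
      rw [le_div_iff₀ hB1] at this
      linarith
    have hl1 : Tendsto (fun k => φ (t, x t, fun j =>
        (b - t)⁻¹ * ((∫ s in (0 : ℝ)..b, (θ k s).2.2 j) - ∫ s in (0 : ℝ)..t, (θ k s).2.2 j))) l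
        (𝓝 (φ (t, x t, fun j => slope (Yu j) t b))) := by
      refine (hφ.tendsto _).comp ?_
      refine tendsto_const_nhds.prodMk_nhds (tendsto_const_nhds.prodMk_nhds ?_)
      refine tendsto_pi_nhds.2 fun j => ?_
      simp only [slope, vsub_eq_sub, smul_eq_mul]
      exact ((hYu j b).sub (hYu j t)).const_mul _
    have hl2 : Tendsto (fun k =>
        (b - t)⁻¹ * ((∫ s in (0 : ℝ)..b, φ (θ k s)) - ∫ s in (0 : ℝ)..t, φ (θ k s)) + η) l
        (𝓝 (slope Y t b + η)) := by
      simp only [slope, vsub_eq_sub, smul_eq_mul]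
      exact (((hY b).sub (hY t)).const_mul _).add_const _
    refine le_of_tendsto_of_tendsto hl1 hl2 ?_
    have hclose : ∀ᶠ k in (l : Filter ℕ), dist (y k t) (x t) < r / 4 :=
      (hx t).eventually (Metric.ball_mem_nhds _ (by linarith))
    filter_upwards [htr δ hδ0, hclose] with k hk1 hk2
    have hcj : ∀ j : Fin m, Continuous (fun z : ℝ × (Fin n → ℝ) × (Fin m → ℝ) => z.2.2 j) :=
      fun j => by fun_prop
    have hcu : Continuous (fun z : ℝ × (Fin n → ℝ) × (Fin m → ℝ) => z.2.2) := by fun_prop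
    have hcφ : Continuous (fun z : ℝ × (Fin n → ℝ) × (Fin m → ℝ) => φ (t, x t, z.2.2)) := by
      fun_prop
    have hiu := ii_comp hK hcu (hθ k) (hθK k) t b
    have hiφ := ii_comp hK hcφ (hθ k) (hθK k) t b
    have hiφ' := ii_comp hK hφ (hθ k) (hθK k) t b
    have e1 : ∀ j, (∫ s in (0 : ℝ)..b, (θ k s).2.2 j) - ∫ s in (0 : ℝ)..t, (θ k s).2.2 j =
        ∫ s in t..b, (θ k s).2.2 j := fun j =>
      intervalIntegral.integral_interval_sub_left (ii_comp hK (hcj j) (hθ k) (hθK k) _ _)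
        (ii_comp hK (hcj j) (hθ k) (hθK k) _ _)
    rw [intervalIntegral.integral_interval_sub_left (ii_comp hK hφ (hθ k) (hθK k) _ _)
        (ii_comp hK hφ (hθ k) (hθK k) _ _)]
    simp only [e1]
    have hvol : volume (Ioc t b) ≠ 0 := by
      rw [Real.volume_Ioc]; simpa using hb.1
    have hJ := (hconv t (x t)).map_set_average_le (μ := volume) (t := Ioc t b)
      (f := fun s => (θ k s).2.2)
      (by fun_prop) isClosed_univ hvol (by simp) (by simp) hiu.1 hiφ.1
    rw [← uIoc_of_le hb.1.le, interval_average_eq, interval_average_eq, smul_eq_mul] at hJ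
    have e2 : (fun j => (b - t)⁻¹ * ∫ s in t..b, (θ k s).2.2 j) =
        (b - t)⁻¹ • ∫ s in t..b, (θ k s).2.2 := by
      ext j
      rw [Pi.smul_apply, smul_eq_mul, intervalIntegral.integral_of_le hb.1.le,
        intervalIntegral.integral_of_le hb.1.le,
        eval_integral (fun i => (ii_comp hK (hcj i) (hθ k) (hθK k) t b).1)]
    rw [e2]
    refine hJ.trans ?_
    have hmono : ∫ s in t..b, φ (t, x t, (θ k s).2.2) ≤ ∫ s in t..b, (φ (θ k s) + η) := by
      refine intervalIntegral.integral_mono_on hb.1.le hiφ (hiφ'.add (by simp)) fun s hs => ?_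
      obtain ⟨hd1, hd2⟩ := hk1 s ⟨by linarith [hs.1], by linarith [hs.2]⟩
      have hzK := hθK k s
      have hd3 : dist (y k s) (y k t) ≤ B * (s - t) := by
        have := (hy k).dist_le_mul s t
        rwa [Real.dist_eq, abs_of_nonneg (by linarith [hs.1])] at this
      have hsb : (B + 1 : ℝ) * (s - t) ≤ r / 4 :=
        (mul_le_mul_of_nonneg_left (by linarith [hs.2]) hB1.le).trans hb2
      have hB0 : 0 ≤ (B : ℝ) * (s - t) := mul_nonneg B.2 (by linarith [hs.1])
      have hst : 0 ≤ s - t := by linarith [hs.1]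
      have hst' : dist s t = s - t := by rw [Real.dist_eq, abs_of_nonneg hst]
      have hdd : dist (t, x t, (θ k s).2.2) (θ k s) < r := by
        rw [dist_comm]
        refine max_lt ?_ (max_lt ?_ ?_)
        · have := dist_triangle (θ k s).1 s t
          simp only
          nlinarith
        · have a1 := dist_triangle (θ k s).2.1 (y k s) (x t)
          have a2 := dist_triangle (y k s) (y k t) (x t)
          simp only
          nlinarith
        · simpa using hr
      have := huc (t, x t, (θ k s).2.2) ⟨⟨ht1.le, ht2.le⟩, hxX, hzK.2.2⟩ (θ k s) hzK hdd
      rw [Real.dist_eq] at this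
      linarith [(abs_lt.1 this).2]
    rw [intervalIntegral.integral_add hiφ' (by simp), intervalIntegral.integral_const,
      smul_eq_mul] at hmono
    have := mul_le_mul_of_nonneg_left hmono (inv_nonneg.2 hbt.le)
    rw [mul_add, ← mul_assoc _ (b - t) η, inv_mul_cancel₀ hbt.ne', one_mul] at this
    exact this
  -- pass to the limit
  have hm : Ioo t (t + τ₀) ∈ 𝓝[>] t := Ioo_mem_nhdsGT (by linarith)
  have hl1 : Tendsto (fun b => φ (t, x t, fun j => slope (Yu j) t b)) (𝓝[>] t)
      (𝓝 (φ (t, x t, fun j => deriv (Yu j) t))) := by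
    refine (hφ.tendsto _).comp ?_
    refine tendsto_const_nhds.prodMk_nhds (tendsto_const_nhds.prodMk_nhds ?_)
    refine tendsto_pi_nhds.2 fun j => ?_
    have := (hdu j).hasDerivAt.hasDerivWithinAt (s := Ioi t)
    rwa [hasDerivWithinAt_iff_tendsto_slope' (by simp)] at this
  have hl2 : Tendsto (fun b => slope Y t b + η) (𝓝[>] t) (𝓝 (deriv Y t + η)) := by
    have := hdY.hasDerivAt.hasDerivWithinAt (s := Ioi t)
    rw [hasDerivWithinAt_iff_tendsto_slope' (by simp)] at this
    exact this.add_const _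
  refine le_of_tendsto_of_tendsto hl1 hl2 ?_
  filter_upwards [hm] with b hb using hslope b hb

end closure

section closure2
open Filter Topology
variable {n m : ℕ} {X XT : Set (Fin n → ℝ)}
    {G : ℝ × (Fin n → ℝ) × (Fin m → ℝ) → Fin n → ℝ} {T : ℝ}

lemma Kcompact (hX : IsCompact X) (m : ℕ) (T : ℝ) :
    IsCompact (Icc (0 : ℝ) T ×ˢ X ×ˢ Ubox m) :=
  isCompact_Icc.prod (hX.prod isCompact_Icc)

lemma lip_ftc {Y : ℝ → ℝ} {C : NNReal} (hY : LipschitzWith C Y) (a b : ℝ) :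
    ∫ t in a..b, deriv Y t = Y b - Y a :=
  ((hY.lipschitzOnWith (s := uIcc a b)).absolutelyContinuousOnInterval).integral_deriv_eq_sub

lemma exists_nnbound {Z V : Type*} [TopologicalSpace Z] [NormedAddCommGroup V] {K : Set Z}
    (hK : IsCompact K) {φ : Z → V} (hφ : Continuous φ) :
    ∃ C : NNReal, ∀ z ∈ K, ‖φ z‖ ≤ C := by
  obtain ⟨C, hC⟩ := hK.exists_bound_of_continuousOn hφ.continuousOn
  exact ⟨C.toNNReal, fun z hz => (hC z hz).trans (Real.le_coe_toNNReal C)⟩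

lemma integrableOn_pair {V : Type*} [NormedAddCommGroup V] [NormedSpace ℝ V]
    [FiniteDimensional ℝ V] {K : Set (ℝ × (Fin n → ℝ) × (Fin m → ℝ))}
    (hK : IsCompact K) {φ : ℝ × (Fin n → ℝ) × (Fin m → ℝ) → V} (hφ : Continuous φ)
    {x : ℝ → Fin n → ℝ} {u : ℝ → Fin m → ℝ} (hx : ContinuousOn x (Icc 0 T)) (hu : Measurable u)
    (hxu : ∀ t ∈ Icc (0 : ℝ) T, (t, x t, u t) ∈ K) :
    IntegrableOn (fun s => φ (s, x s, u s)) (Icc 0 T) volume := by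
  obtain ⟨C, hC⟩ := hK.exists_bound_of_continuousOn hφ.continuousOn
  refine IntegrableOn.of_bound (by simp) ?_ C ?_
  · refine hφ.comp_aestronglyMeasurable ?_
    refine AEMeasurable.aestronglyMeasurable ?_
    exact aemeasurable_id.prodMk ((hx.aemeasurable measurableSet_Icc).prodMk hu.aemeasurable)
  · filter_upwards [ae_restrict_mem measurableSet_Icc] with s hs using hC _ (hxu s hs)

lemma closure_lemma (hX : IsCompact X) (hXT : IsCompact XT) (hXTsub : XT ⊆ X) (hT : 0 < T)
    {x₀ : Fin n → ℝ} (hx₀ : x₀ ∈ X)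
    {f : ℝ × (Fin n → ℝ) → Fin n → ℝ} {g : ℝ × (Fin n → ℝ) → Fin n → Fin m → ℝ}
    (hG : Continuous G) (hGF : ∀ z ∈ Icc (0 : ℝ) T ×ˢ X ×ˢ Ubox m, G z = Fvec f g z)
    (hGc : ∀ i t x, ConvexOn ℝ univ (fun u => G (t, x, u) i) ∧
      ConvexOn ℝ univ (fun u => - G (t, x, u) i))
    (l : Ultrafilter ℕ) {θ : ℕ → ℝ → ℝ × (Fin n → ℝ) × (Fin m → ℝ)}
    (hθ : ∀ k, Measurable (θ k)) (hθK : ∀ k s, θ k s ∈ Icc (0 : ℝ) T ×ˢ X ×ˢ Ubox m)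
    (a : ℕ → Fin n → ℝ) (ha : Tendsto a l (𝓝 x₀)) (yT : ℕ → Fin n → ℝ) (hyT : ∀ k, yT k ∈ XT)
    (hend : Tendsto (fun k => dist (yT k) (a k + ∫ s in (0 : ℝ)..T, G (θ k s))) l (𝓝 0))
    (htr : ∀ δ > 0, ∀ᶠ k in (l : Filter ℕ), ∀ s ∈ Ioo δ (T - δ),
      dist (θ k s).1 s ≤ δ ∧ dist (θ k s).2.1 (a k + ∫ r in (0 : ℝ)..s, G (θ k r)) ≤ δ) :
    ∃ (x : ℝ → Fin n → ℝ) (u : ℝ → Fin m → ℝ), IsAdmissiblePair T X XT x₀ f g x u ∧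
      Tendsto yT l (𝓝 (x T)) ∧
      ∀ φ : ℝ × (Fin n → ℝ) × (Fin m → ℝ) → ℝ, Continuous φ →
        (∀ t x, ConvexOn ℝ univ (fun u => φ (t, x, u))) → ∀ c : ℝ,
        Tendsto (fun k => ∫ s in (0 : ℝ)..T, φ (θ k s)) l (𝓝 c) →
        ∫ s in Icc (0 : ℝ) T, φ (s, x s, u s) ≤ c := by
  have hK := Kcompact hX m T
  obtain ⟨B, hB⟩ := exists_nnbound hK hG
  obtain ⟨YG, hYG, hYGL⟩ := limfun hK l hθ hθK hG hB
  have hcj : ∀ j : Fin m, Continuous (fun z : ℝ × (Fin n → ℝ) × (Fin m → ℝ) => z.2.2 j) :=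
    fun j => by fun_prop
  have hU : ∀ j : Fin m, ∀ z ∈ Icc (0 : ℝ) T ×ˢ X ×ˢ Ubox m, ‖z.2.2 j‖ ≤ (1 : NNReal) := by
    intro j z hz
    rw [Real.norm_eq_abs, abs_le]
    exact ⟨by simpa using hz.2.2.1 j, by simpa using hz.2.2.2 j⟩
  have hYu' := fun j => limfun hK l hθ hθK (hcj j) (hU j)
  choose Yu hYu hYuL using hYu'
  set x : ℝ → Fin n → ℝ := fun t => x₀ + YG t with hxdef
  set u : ℝ → Fin m → ℝ := fun t j => deriv (Yu j) t with hudef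
  set y : ℕ → ℝ → Fin n → ℝ := fun k t => a k + ∫ s in (0 : ℝ)..t, G (θ k s) with hydef
  have hyL : ∀ k, LipschitzWith B (y k) := by
    intro k
    refine LipschitzWith.of_dist_le_mul fun s t => ?_
    rw [hydef, dist_add_left, dist_eq_norm,
      intervalIntegral.integral_interval_sub_left (ii_comp hK hG (hθ k) (hθK k) _ _)
      (ii_comp hK hG (hθ k) (hθK k) _ _), Real.dist_eq]
    exact norm_II_le (hθK k) hB t s
  have hx : ∀ t, Tendsto (fun k => y k t) l (𝓝 (x t)) := fun t => ha.add (hYG t)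
  have hxc : Continuous x := continuous_const.add hYGL.continuous
  have hum : Measurable u := measurable_pi_lambda _ fun j => measurable_deriv (Yu j)
  have huU : ∀ t, u t ∈ Ubox m := by
    intro t
    have hn : ∀ j, |u t j| ≤ 1 := fun j => by
      have := norm_deriv_le_of_lipschitz (hYuL j) (x₀ := t)
      simpa using this
    exact ⟨fun j => (abs_le.1 (hn j)).1, fun j => (abs_le.1 (hn j)).2⟩
  have hYG0 : YG 0 = 0 := by
    refine tendsto_nhds_unique (hYG 0) ?_
    simp
  have hx0 : x 0 = x₀ := by simp [hxdef, hYG0]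
  have hyTlim : Tendsto yT l (𝓝 (x T)) := by
    rw [tendsto_iff_dist_tendsto_zero]
    have h1 := (tendsto_iff_dist_tendsto_zero.1 (hx T))
    have h2 := hend.add h1
    rw [add_zero] at h2
    exact squeeze_zero (fun _ => dist_nonneg) (fun k => dist_triangle _ _ _) h2
  have hxT : x T ∈ XT := hXT.isClosed.mem_of_tendsto hyTlim (Eventually.of_forall hyT)
  have hxmid : ∀ t ∈ Ioo 0 T, x t ∈ X := by
    intro t ht
    have : Tendsto (fun k => (θ k t).2.1) l (𝓝 (x t)) := by
      rw [Metric.tendsto_nhds]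
      intro e he
      have ht1 := ht.1
      have ht2 := ht.2
      set δ := min (e / 2) (min (t / 2) ((T - t) / 2)) with hδ
      have hδ0 : 0 < δ := lt_min (by linarith) (lt_min (by linarith) (by linarith))
      have hδ1 : δ ≤ e / 2 := min_le_left _ _
      have hδ2 : δ ≤ t / 2 := (min_le_right _ _).trans (min_le_left _ _)
      have hδ3 : δ ≤ (T - t) / 2 := (min_le_right _ _).trans (min_le_right _ _)
      filter_upwards [htr δ hδ0, Metric.tendsto_nhds.1 (hx t) (e / 2) (by linarith)] with k h1 h2
      have h3 := (h1 t ⟨by linarith, by linarith⟩).2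
      have h4 := dist_triangle (θ k t).2.1 (y k t) (x t)
      linarith
    exact hX.isClosed.mem_of_tendsto this (Eventually.of_forall fun k => (hθK k t).2.1)
  have hxX : ∀ t ∈ Icc 0 T, x t ∈ X := by
    intro t ht
    rcases eq_or_lt_of_le ht.1 with h0 | h0
    · rw [← h0, hx0]; exact hx₀
    rcases eq_or_lt_of_le ht.2 with h1 | h1
    · rw [h1]; exact hXTsub hxT
    · exact hxmid t ⟨h0, h1⟩
  have hpair : ∀ t ∈ Icc (0 : ℝ) T, (t, x t, u t) ∈ Icc (0 : ℝ) T ×ˢ X ×ˢ Ubox m :=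
    fun t ht => ⟨ht, hxX t ht, huU t⟩
  -- Jensen a.e.
  have hduae : ∀ᵐ t : ℝ, ∀ j, DifferentiableAt ℝ (Yu j) t :=
    ae_all_iff.2 fun j => (hYuL j).ae_differentiableAt_real
  have hmain : ∀ φ : ℝ × (Fin n → ℝ) × (Fin m → ℝ) → ℝ, Continuous φ →
      (∀ t x, ConvexOn ℝ univ (fun u => φ (t, x, u))) → ∀ (Y : ℝ → ℝ) (C : NNReal),
      LipschitzWith C Y →
      (∀ t, Tendsto (fun k => ∫ s in (0 : ℝ)..t, φ (θ k s)) l (𝓝 (Y t))) →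
      ∀ᵐ t : ℝ, t ∈ Ioo 0 T → φ (t, x t, u t) ≤ deriv Y t := by
    intro φ hφ hφc Y C hYL hY
    filter_upwards [hduae, hYL.ae_differentiableAt_real] with t h1 h2 ht
    exact key_jensen hK l hθ hθK y hyL x hx htr Yu hYu hφ hφc Y hY ht (hxmid t ht) h2 h1
  have hIoo : ∀ᵐ t : ℝ, t ≠ 0 ∧ t ≠ T := by
    have h1 : ∀ᵐ r : ℝ, r ≠ 0 := by simp [ae_iff]
    have h2 : ∀ᵐ r : ℝ, r ≠ T := by simp [ae_iff]
    filter_upwards [h1, h2] with t a b using ⟨a, b⟩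
  -- the components of G
  have hGi : ∀ i, Continuous (fun z => G z i) := fun i => by fun_prop
  have hYGi : ∀ i t, Tendsto (fun k => ∫ s in (0 : ℝ)..t, G (θ k s) i) l (𝓝 (YG t i)) := by
    intro i t
    have := ((continuous_apply i).tendsto (YG t)).comp (hYG t)
    refine this.congr fun k => ?_
    simp only [Function.comp]
    rw [intervalIntegral, intervalIntegral, Pi.sub_apply,
      eval_integral (fun i => (ii_comp hK (hGi i) (hθ k) (hθK k) 0 t).1),
      eval_integral (fun i => (ii_comp hK (hGi i) (hθ k) (hθK k) 0 t).2)]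
  have hYGiL : ∀ i, LipschitzWith B (fun t => YG t i) := by
    intro i
    refine LipschitzWith.of_dist_le_mul fun s t => ?_
    exact (dist_le_pi_dist _ _ i).trans (hYGL.dist_le_mul s t)
  have hode : ∀ᵐ t : ℝ, t ∈ Ioo 0 T → ∀ i, G (t, x t, u t) i = deriv (fun t => YG t i) t := by
    have h1 := ae_all_iff.2 fun i =>
      hmain (fun z => G z i) (hGi i) (fun t x => (hGc i t x).1) _ B (hYGiL i) (hYGi i)
    have h2 := ae_all_iff.2 fun i =>
      hmain (fun z => - G z i) (hGi i).neg (fun t x => (hGc i t x).2) (fun t => - YG t i) B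
        (hYGiL i).neg (fun t => by
          simpa only [intervalIntegral.integral_neg] using (hYGi i t).neg)
    filter_upwards [h1, h2] with t h1 h2 ht i
    refine le_antisymm (h1 i ht) ?_
    have := h2 i ht
    rw [deriv.fun_neg] at this
    linarith
  have hIntg := integrableOn_pair hK hG hxc.continuousOn hum hpair
  have hGF' : ∀ t ∈ Icc (0 : ℝ) T, G (t, x t, u t) = Fvec f g (t, x t, u t) :=
    fun t ht => hGF _ (hpair t ht)
  refine ⟨x, u, ⟨hum, fun t _ => huU t, hx0, hxT, hxX, ?_, ?_⟩, hyTlim, ?_⟩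
  · exact hIntg.congr_fun hGF' measurableSet_Icc
  · intro t ht
    have e1 : ∫ s in Icc 0 t, Fvec f g (s, x s, u s) = ∫ s in Icc 0 t, G (s, x s, u s) :=
      setIntegral_congr_fun measurableSet_Icc fun s hs => (hGF' s ⟨hs.1, hs.2.trans ht.2⟩).symm
    rw [e1]
    have hIntg' : IntegrableOn (fun s => G (s, x s, u s)) (Icc 0 t) volume :=
      hIntg.mono_set (Icc_subset_Icc_right ht.2)
    simp only [hxdef]
    congr 1
    ext i
    rw [eval_integral (fun i => Integrable.eval hIntg' i)]
    have e2 := lip_ftc (hYGiL i) 0 t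
    rw [hYG0, Pi.zero_apply, sub_zero] at e2
    rw [← e2, intervalIntegral.integral_of_le ht.1, ← integral_Icc_eq_integral_Ioc]
    refine setIntegral_congr_ae measurableSet_Icc ?_
    filter_upwards [hode, hIoo] with s hs hs' hs''
    exact (hs ⟨lt_of_le_of_ne hs''.1 (Ne.symm hs'.1),
      lt_of_le_of_ne (hs''.2.trans ht.2) hs'.2⟩ i).symm
  · intro φ hφ hφc c hc
    obtain ⟨C, hC⟩ := exists_nnbound hK hφ
    obtain ⟨Y, hY, hYL⟩ := limfun hK l hθ hθK hφ hC
    have hY0 : Y 0 = 0 := by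
      refine tendsto_nhds_unique (hY 0) ?_
      simp
    have hcY : c = Y T := tendsto_nhds_unique hc (hY T)
    have e2 := lip_ftc hYL 0 T
    rw [hY0, sub_zero] at e2
    rw [hcY, ← e2, intervalIntegral.integral_of_le hT.le, ← integral_Icc_eq_integral_Ioc]
    have hdi := ((hYL.lipschitzOnWith
      (s := uIcc 0 T)).absolutelyContinuousOnInterval).intervalIntegrable_deriv
    rw [intervalIntegrable_iff_integrableOn_Icc_of_le hT.le] at hdi
    refine setIntegral_mono_on_ae
      (integrableOn_pair hK hφ hxc.continuousOn hum hpair) hdi measurableSet_Icc ?_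
    filter_upwards [hmain φ hφ hφc Y C hYL hY, hIoo] with s hs hs' hs''
    exact hs ⟨lt_of_le_of_ne hs''.1 (Ne.symm hs'.1), lt_of_le_of_ne hs''.2 hs'.2⟩

end closure2

section cont
open Filter Topology
variable {n m : ℕ}

lemma LFop_eq (f : ℝ × (Fin n → ℝ) → Fin n → ℝ) (g : ℝ × (Fin n → ℝ) → Fin n → Fin m → ℝ)
    (v : ℝ × (Fin n → ℝ) → ℝ) (z : ℝ × (Fin n → ℝ) × (Fin m → ℝ)) :
    LFop f g v z = fderiv ℝ v (z.1, z.2.1) ((1 : ℝ), Fvec f g z) := by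
  have : ((1 : ℝ), Fvec f g z) = ((1 : ℝ), (0 : Fin n → ℝ)) +
      ∑ k, Fvec f g z k • ((0 : ℝ), (Pi.single k (1 : ℝ) : Fin n → ℝ)) := by
    ext i
    · simp [Prod.fst_sum]
    · simp [Prod.snd_sum, Finset.sum_apply, Pi.single_apply]
  rw [this, map_add, map_sum, LFop]
  congr 1
  refine Finset.sum_congr rfl fun k _ => ?_
  rw [map_smul, smul_eq_mul, mul_comm]

lemma LFop_split (f : ℝ × (Fin n → ℝ) → Fin n → ℝ) (g : ℝ × (Fin n → ℝ) → Fin n → Fin m → ℝ)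
    (v : ℝ × (Fin n → ℝ) → ℝ) (z : ℝ × (Fin n → ℝ) × (Fin m → ℝ)) :
    LFop f g v z = Lfop f v (z.1, z.2.1) + ∑ j, z.2.2 j * Lgop g v j (z.1, z.2.1) := by
  simp only [LFop, Lfop, Lgop, Fvec, mul_add, Finset.sum_add_distrib, Finset.mul_sum]
  rw [add_assoc]
  congr 2
  rw [Finset.sum_comm]
  refine Finset.sum_congr rfl fun j _ => Finset.sum_congr rfl fun k _ => by ring

lemma Fvec_cont {f : ℝ × (Fin n → ℝ) → Fin n → ℝ} {g : ℝ × (Fin n → ℝ) → Fin n → Fin m → ℝ}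
    (hf : Continuous f) (hg : Continuous g) : Continuous (Fvec f g) := by
  unfold Fvec
  fun_prop

lemma Fvec_conv (f : ℝ × (Fin n → ℝ) → Fin n → ℝ) (g : ℝ × (Fin n → ℝ) → Fin n → Fin m → ℝ)
    (i : Fin n) (t : ℝ) (x : Fin n → ℝ) :
    ConvexOn ℝ univ (fun u => Fvec f g (t, x, u) i) ∧
      ConvexOn ℝ univ (fun u => - Fvec f g (t, x, u) i) := by
  have key : ∀ (u w : Fin m → ℝ) (a b : ℝ), a + b = 1 →
      Fvec f g (t, x, a • u + b • w) i = a * Fvec f g (t, x, u) i + b * Fvec f g (t, x, w) i := by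
    intro u w a b hab
    simp only [Fvec, Pi.add_apply, Pi.smul_apply, smul_eq_mul, mul_add, Finset.sum_add_distrib,
      Finset.mul_sum]
    have : f (t, x) i = a * f (t, x) i + b * f (t, x) i := by rw [← add_mul, hab, one_mul]
    have e1 : ∀ (c : ℝ) (y : Fin m → ℝ), ∑ j, g (t, x) i j * (c * y j)
        = ∑ j, c * (g (t, x) i j * y j) :=
      fun c y => Finset.sum_congr rfl fun j _ => by ring
    rw [e1, e1]
    linarith
  refine ⟨⟨convex_univ, ?_⟩, ⟨convex_univ, ?_⟩⟩ <;> intro u _ w _ a b _ _ hab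
  · simp only [smul_eq_mul]; exact (key u w a b hab).le
  · simp only [smul_eq_mul]; rw [key u w a b hab]; linarith

variable {T : ℝ} {X XT : Set (Fin n → ℝ)} {x₀ : Fin n → ℝ}
    {f : ℝ × (Fin n → ℝ) → Fin n → ℝ} {g : ℝ × (Fin n → ℝ) → Fin n → Fin m → ℝ}

lemma nogap (hX : IsCompact X) (hXT : IsCompact XT) (hXTsub : XT ⊆ X) (hT : 0 < T)
    (hx₀ : x₀ ∈ X) (hf : Continuous f) (hg : Continuous g)
    {h : ℝ × (Fin n → ℝ) × (Fin m → ℝ) → ℝ} {H : (Fin n → ℝ) → ℝ}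
    (hh : Continuous h) (hH : Continuous H)
    (hconv : ∀ t x, ConvexOn ℝ univ (fun u => h (t, x, u)))
    (μ : Measure (ℝ × (Fin n → ℝ) × (Fin m → ℝ))) (μT : Measure (Fin n → ℝ))
    [IsFiniteMeasure μ] [IsFiniteMeasure μT]
    (hμ : μ ((Icc (0 : ℝ) T ×ˢ X ×ˢ Ubox m)ᶜ) = 0) (hμT : μT (XTᶜ) = 0)
    (hL : SatisfiesLiouville T x₀ f g μ μT) :
    ∃ x u, IsAdmissiblePair T X XT x₀ f g x u ∧ Jcost T h H x u ≤ Qcost h H μ μT := by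
  have hK := Kcompact hX m T
  have hG : Continuous (Fvec f g) := Fvec_cont hf hg
  have hne : (Icc (0 : ℝ) T ×ˢ X ×ˢ Ubox m).Nonempty :=
    ⟨(0, x₀, 0), ⟨le_rfl, hT.le⟩, hx₀, fun j => by simp, fun j => by simp⟩
  obtain ⟨B, hB⟩ := exists_nnbound hK hG
  obtain ⟨C, hC⟩ := exists_nnbound hK hh
  have hL' : ∀ v : ℝ × (Fin n → ℝ) → ℝ, ContDiff ℝ 1 v → v (0, x₀) + ∫ z, fderiv ℝ v (z.1, z.2.1)
      ((1 : ℝ), Fvec f g z) ∂μ = ∫ y, v (T, y) ∂μT := by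
    intro v hv
    simpa only [LFop_eq] using hL v hv
  set ε : ℕ → ℝ := fun k => 1 / ((k : ℝ) + 1) with hεdef
  have hε : ∀ k, 0 < ε k := fun k => by positivity
  have hεlim : Tendsto ε atTop (𝓝 0) := tendsto_one_div_add_atTop_nhds_zero_nat
  have hex : ∀ k, ∃ (p : ℝ × (Fin n → ℝ)) (t₁ : ℝ) (y : Fin n → ℝ)
      (θ : ℝ → ℝ × (Fin n → ℝ) × (Fin m → ℝ)), dist p (0, x₀) < ε k ∧ 
      p.1 ≤ t₁ ∧ |t₁ - T| < ε k ∧ y ∈ XT ∧ Measurable θ ∧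
      (∀ s, θ s ∈ Icc (0 : ℝ) T ×ˢ X ×ˢ Ubox m) ∧
      dist (p.2 + ∫ s in p.1..t₁, Fvec f g (θ s)) y < ε k ∧
      (∫ s in p.1..t₁, h (θ s)) + H y < Qcost h H μ μT + ε k ∧
      ∀ s ∈ Ico p.1 t₁, dist (θ s).1 s ≤ 2 * ε k ∧
        dist (θ s).2.1 (p.2 + ∫ r in p.1..s, Fvec f g (θ r)) ≤ (1 + B) * ε k := by
    intro k
    obtain ⟨p, c, hc, hp, hcc⟩ := chain_exists hK hXT hG hh hH x₀ μ μT hμ hμT hL' (hε k)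
    obtain ⟨t₁, y, θ, h1, h2, h3, h4, h5, h6, h7, h8⟩ := chain_fun hK hG hh hB hne (hε k) hc
    exact ⟨p, t₁, y, θ, hp, h1, h2, h3, h4, h5, h6, by rw [← h7]; exact hcc, h8⟩
  choose p t₁ yT θ hp h1 h2 hyT hθ hθK h6 h7 h8 using hex
  have hp1 : ∀ k, |(p k).1| < ε k := fun k => by
    have := lt_of_le_of_lt (le_max_left _ _) (hp k)
    simpa [Real.dist_eq] using this
  have hp2 : ∀ k, dist (p k).2 x₀ < ε k := fun k => lt_of_le_of_lt (le_max_right _ _) (hp k)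
  set l : Ultrafilter ℕ := Filter.hyperfilter ℕ with hl
  have hlat : (l : Filter ℕ) ≤ atTop := Nat.hyperfilter_le_atTop
  have hεl : Tendsto ε l (𝓝 0) := hεlim.mono_left hlat
  have hεc : ∀ c : ℝ, Tendsto (fun k => c * ε k) l (𝓝 0) := fun c => by
    simpa using hεl.const_mul c
  set a : ℕ → Fin n → ℝ := fun k => (p k).2 + ∫ s in (p k).1..0, Fvec f g (θ k s) with hadef
  have hadd : ∀ k s, a k + ∫ r in (0 : ℝ)..s, Fvec f g (θ k r)
      = (p k).2 + ∫ r in (p k).1..s, Fvec f g (θ k r) := by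
    intro k s
    rw [hadef, add_assoc, intervalIntegral.integral_add_adjacent_intervals
      (ii_comp hK hG (hθ k) (hθK k) _ _) (ii_comp hK hG (hθ k) (hθK k) _ _)]
  have ha : Tendsto a l (𝓝 x₀) := by
    rw [tendsto_iff_dist_tendsto_zero]
    refine squeeze_zero (fun _ => dist_nonneg) (fun k => ?_) (hεc (1 + B))
    have e1 := norm_II_le (hθK k) hB (p k).1 0
    have e2 : dist (a k) (p k).2 ≤ B * |0 - (p k).1| := by
      rw [dist_eq_norm, hadef, add_sub_cancel_left]; exact e1
    have e3 := dist_triangle (a k) (p k).2 x₀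
    have e4 : B * |0 - (p k).1| ≤ B * ε k := by
      rw [zero_sub, abs_neg]; exact mul_le_mul_of_nonneg_left (hp1 k).le B.2
    have := hp2 k
    linarith
  have hend : Tendsto (fun k => dist (yT k) (a k + ∫ s in (0 : ℝ)..T, Fvec f g (θ k s))) l
      (𝓝 0) := by
    refine squeeze_zero (fun _ => dist_nonneg) (fun k => ?_) (hεc (1 + B))
    rw [hadd]
    have e1 := norm_II_le (hθK k) hB T (t₁ k)
    have e2 : dist ((p k).2 + ∫ r in (p k).1..(t₁ k), Fvec f g (θ k r))
        ((p k).2 + ∫ r in (p k).1..T, Fvec f g (θ k r)) ≤ B * |t₁ k - T| := by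
      rw [dist_add_left, dist_eq_norm, intervalIntegral.integral_interval_sub_left
        (ii_comp hK hG (hθ k) (hθK k) _ _) (ii_comp hK hG (hθ k) (hθK k) _ _)]
      exact e1
    have e3 := dist_triangle_left (yT k) ((p k).2 + ∫ r in (p k).1..T, Fvec f g (θ k r))
      ((p k).2 + ∫ r in (p k).1..(t₁ k), Fvec f g (θ k r))
    have e4 : B * |t₁ k - T| ≤ B * ε k := mul_le_mul_of_nonneg_left (h2 k).le B.2
    have := h6 k
    linarith
  have htr : ∀ δ > 0, ∀ᶠ k in (l : Filter ℕ), ∀ s ∈ Ioo δ (T - δ),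
      dist (θ k s).1 s ≤ δ ∧
        dist (θ k s).2.1 (a k + ∫ r in (0 : ℝ)..s, Fvec f g (θ k r)) ≤ δ := by
    intro δ hδ
    filter_upwards [(hεc (3 + B)).eventually_lt_const hδ] with k hk s hs
    have hB0 : 0 ≤ B * ε k := mul_nonneg B.2 (hε k).le
    have hk' : 3 * ε k + B * ε k < δ := by linarith
    have hek := hε k
    have e1 := abs_lt.1 (hp1 k)
    have e2 := abs_lt.1 (h2 k)
    obtain ⟨q1, q2⟩ := h8 k s ⟨by linarith [hs.1], by linarith [hs.2]⟩
    rw [hadd]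
    exact ⟨by linarith, by linarith⟩
  obtain ⟨x, u, hadm, hxT, hlow⟩ := closure_lemma hX hXT hXTsub hT hx₀ hG (fun _ _ => rfl)
    (Fvec_conv f g) l hθ hθK a ha yT hyT hend htr
  refine ⟨x, u, hadm, ?_⟩
  obtain ⟨c, hc⟩ := ultra_lim l (fun k => ∫ s in (0 : ℝ)..T, h (θ k s)) _
    (fun k => norm_II_le (hθK k) hC 0 T)
  have hle := hlow h hh hconv c hc
  have hHlim : Tendsto (fun k => H (yT k)) l (𝓝 (H (x T))) := (hH.tendsto _).comp hxT
  have hbound : ∀ k, (∫ s in (0 : ℝ)..T, h (θ k s)) + H (yT k)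
      ≤ Qcost h H μ μT + (1 + 2 * C) * ε k := by
    intro k
    have i := ii_comp hK hh (hθ k) (hθK k)
    have e1 := intervalIntegral.integral_add_adjacent_intervals (i 0 (p k).1) (i (p k).1 (t₁ k))
    have e2 := intervalIntegral.integral_add_adjacent_intervals (i 0 (t₁ k)) (i (t₁ k) T)
    have n1 := (le_abs_self _).trans (norm_II_le (hθK k) hC 0 (p k).1)
    have n2 := (le_abs_self _).trans (norm_II_le (hθK k) hC (t₁ k) T)
    have n3 : C * |(p k).1 - 0| ≤ C * ε k := by
      rw [sub_zero]; exact mul_le_mul_of_nonneg_left (hp1 k).le C.2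
    have n4 : C * |T - t₁ k| ≤ C * ε k := by
      rw [abs_sub_comm]; exact mul_le_mul_of_nonneg_left (h2 k).le C.2
    have := h7 k
    linarith
  have hfin : c + H (x T) ≤ Qcost h H μ μT + 0 :=
    le_of_tendsto_of_tendsto (hc.add hHlim) ((hεc (1 + 2 * C)).const_add _)
      (Eventually.of_forall hbound)
  unfold Jcost
  linarith

end cont

section occ
open Filter Topology
variable {n m : ℕ} {T : ℝ} {X XT : Set (Fin n → ℝ)} {x₀ : Fin n → ℝ}
    {f : ℝ × (Fin n → ℝ) → Fin n → ℝ} {g : ℝ × (Fin n → ℝ) → Fin n → Fin m → ℝ}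

lemma adm_continuousOn {x : ℝ → Fin n → ℝ} {u : ℝ → Fin m → ℝ}
    (hadm : IsAdmissiblePair T X XT x₀ f g x u) : ContinuousOn x (Icc 0 T) := by
  obtain ⟨hu, huU, h0, hxT, hxX, hIntg, hode⟩ := hadm
  exact (continuousOn_const.add
    (intervalIntegral.continuousOn_primitive_Icc hIntg)).congr fun t ht => hode t ht

lemma adm_param (hT : 0 < T) {x : ℝ → Fin n → ℝ} {u : ℝ → Fin m → ℝ}
    (hadm : IsAdmissiblePair T X XT x₀ f g x u) :
    ∃ θ : ℝ → ℝ × (Fin n → ℝ) × (Fin m → ℝ), Measurable θ ∧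
      (∀ s, θ s ∈ Icc (0 : ℝ) T ×ˢ X ×ˢ Ubox m) ∧ (∀ t ∈ Icc 0 T, θ t = (t, x t, u t)) ∧
      ∀ t ∈ Icc 0 T, x t = x₀ + ∫ s in (0 : ℝ)..t, Fvec f g (θ s) := by
  have hxc := adm_continuousOn hadm
  obtain ⟨hu, huU, h0, hxT, hxX, hIntg, hode⟩ := hadm
  set c : ℝ → ℝ := fun t => max 0 (min T t) with hc
  have hcc : Continuous c := by fun_prop
  have hcI : ∀ t, c t ∈ Icc 0 T := fun t => ⟨le_max_left _ _, max_le hT.le (min_le_left _ _)⟩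
  have hcid : ∀ t ∈ Icc 0 T, c t = t := fun t ht => by
    simp only [hc]; rw [min_eq_right ht.2, max_eq_right ht.1]
  refine ⟨fun s => (c s, x (c s), u (c s)), ?_, ?_, ?_, ?_⟩
  · exact hcc.measurable.prodMk
      ((hxc.comp_continuous hcc hcI).measurable.prodMk (hu.comp hcc.measurable))
  · exact fun s => ⟨hcI s, hxX _ (hcI s), huU _ (hcI s)⟩
  · intro t ht; simp only [hcid t ht]
  · intro t ht
    rw [hode t ht, intervalIntegral.integral_of_le ht.1, ← integral_Icc_eq_integral_Ioc]
    congr 1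
    refine setIntegral_congr_fun measurableSet_Icc fun s hs => ?_
    simp only [hcid s ⟨hs.1, hs.2.trans ht.2⟩]

lemma param_integral (hT : 0 < T) {V : Type*} [NormedAddCommGroup V] [NormedSpace ℝ V]
    {x : ℝ → Fin n → ℝ} {u : ℝ → Fin m → ℝ}
    {θ : ℝ → ℝ × (Fin n → ℝ) × (Fin m → ℝ)} (hθe : ∀ t ∈ Icc 0 T, θ t = (t, x t, u t))
    (φ : ℝ × (Fin n → ℝ) × (Fin m → ℝ) → V) :
    ∫ s in (0 : ℝ)..T, φ (θ s) = ∫ s in Icc (0 : ℝ) T, φ (s, x s, u s) := by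
  rw [intervalIntegral.integral_of_le hT.le, ← integral_Icc_eq_integral_Ioc]
  refine setIntegral_congr_fun measurableSet_Icc fun s hs => ?_
  simp only [hθe s hs]

lemma liouville_ftc (hX : IsCompact X) (hT : 0 < T) (hf : Continuous f) (hg : Continuous g)
    {x : ℝ → Fin n → ℝ} {θ : ℝ → ℝ × (Fin n → ℝ) × (Fin m → ℝ)} (hθ : Measurable θ)
    (hθK : ∀ s, θ s ∈ Icc (0 : ℝ) T ×ˢ X ×ˢ Ubox m)
    (hθ1 : ∀ t ∈ Icc 0 T, (θ t).1 = t ∧ (θ t).2.1 = x t)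
    (hxθ : ∀ t ∈ Icc 0 T, x t = x₀ + ∫ s in (0 : ℝ)..t, Fvec f g (θ s))
    {v : ℝ × (Fin n → ℝ) → ℝ} (hv : ContDiff ℝ 1 v) :
    v (0, x₀) + ∫ t in Icc 0 T, LFop f g v (θ t) = v (T, x T) := by
  have hK := Kcompact hX m T
  have hG : Continuous (Fvec f g) := Fvec_cont hf hg
  obtain ⟨B, hB⟩ := exists_nnbound hK hG
  set y : ℝ → Fin n → ℝ := fun t => x₀ + ∫ s in (0 : ℝ)..t, Fvec f g (θ s) with hydef
  have hyL : LipschitzWith B y := by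
    refine LipschitzWith.of_dist_le_mul fun s t => ?_
    rw [hydef, dist_add_left, dist_eq_norm,
      intervalIntegral.integral_interval_sub_left (ii_comp hK hG hθ hθK _ _)
      (ii_comp hK hG hθ hθK _ _), Real.dist_eq]
    exact norm_II_le hθK hB t s
  have hY : LipschitzWith (max 1 B) (fun t : ℝ => (t, y t)) := LipschitzWith.id.prodMk hyL
  have hcomp : IsCompact ((fun t : ℝ => (t, y t)) '' Icc 0 T) :=
    isCompact_Icc.image hY.continuous
  obtain ⟨R, hR⟩ := hcomp.isBounded.subset_closedBall 0
  have hfc : Continuous (fderiv ℝ v) := hv.continuous_fderiv one_ne_zero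
  obtain ⟨C, hC⟩ := exists_nnbound (isCompact_closedBall (0 : ℝ × (Fin n → ℝ)) R) hfc
  have hvL : LipschitzOnWith C v (Metric.closedBall 0 R) :=
    (convex_closedBall _ _).lipschitzOnWith_of_nnnorm_fderiv_le
      (fun z _ => (hv.differentiable one_ne_zero) z) (fun z hz => hC z hz)
  have hw : LipschitzOnWith (C * max 1 B) (fun t => v (t, y t)) (uIcc 0 T) := by
    rw [uIcc_of_le hT.le]
    exact hvL.comp hY.lipschitzOnWith (fun t ht => hR ⟨t, ht, rfl⟩)
  have hftc := hw.absolutelyContinuousOnInterval.integral_deriv_eq_sub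
  have hae := (ii_comp hK hG hθ hθK 0 T).ae_hasDerivAt_integral
  rw [uIcc_of_le hT.le] at hae
  have hy0 : y 0 = x₀ := by simp [hydef]
  have e : ∫ t in Icc 0 T, LFop f g v (θ t) = ∫ t in (0 : ℝ)..T, deriv (fun t => v (t, y t)) t := by
    rw [intervalIntegral.integral_of_le hT.le, ← integral_Icc_eq_integral_Ioc]
    refine setIntegral_congr_ae measurableSet_Icc ?_
    filter_upwards [hae] with t ht htI
    have h1 : HasDerivAt y (Fvec f g (θ t)) t := (ht htI 0 ⟨le_rfl, hT.le⟩).const_add x₀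
    have h2 : HasDerivAt (fun t : ℝ => (t, y t)) ((1 : ℝ), Fvec f g (θ t)) t :=
      (hasDerivAt_id t).prodMk h1
    have h3 := ((hv.differentiable one_ne_zero) (t, y t)).hasFDerivAt.comp_hasDerivAt t h2
    rw [LFop_eq, (hθ1 t htI).1, (hθ1 t htI).2, hxθ t htI]
    exact h3.deriv.symm
  rw [e, hftc, hy0, hxθ T ⟨hT.le, le_rfl⟩]
  ring

lemma Lfop_cont (hf : Continuous f) {v : ℝ × (Fin n → ℝ) → ℝ} (hv : ContDiff ℝ 1 v) :
    Continuous (Lfop f v) := by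
  have hfc : Continuous (fderiv ℝ v) := hv.continuous_fderiv one_ne_zero
  unfold Lfop
  fun_prop

lemma Lgop_cont (hg : Continuous g) {v : ℝ × (Fin n → ℝ) → ℝ} (hv : ContDiff ℝ 1 v) (j : Fin m) :
    Continuous (Lgop g v j) := by
  have hfc : Continuous (fderiv ℝ v) := hv.continuous_fderiv one_ne_zero
  unfold Lgop
  fun_prop

lemma LFop_cont (hf : Continuous f) (hg : Continuous g) {v : ℝ × (Fin n → ℝ) → ℝ}
    (hv : ContDiff ℝ 1 v) : Continuous (LFop f g v) := by
  have hfc : Continuous (fderiv ℝ v) := hv.continuous_fderiv one_ne_zero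
  have := Fvec_cont hf hg
  unfold LFop
  fun_prop

lemma occ_feasible (hX : IsCompact X) (hXT : IsCompact XT) (hT : 0 < T)
    (hf : Continuous f) (hg : Continuous g)
    {h : ℝ × (Fin n → ℝ) × (Fin m → ℝ) → ℝ} {H : (Fin n → ℝ) → ℝ}
    (hh : Continuous h)
    {x : ℝ → Fin n → ℝ} {u : ℝ → Fin m → ℝ}
    (hadm : IsAdmissiblePair T X XT x₀ f g x u) :
    Jcost T h H x u ∈ PVals T X XT x₀ f g h H := by
  obtain ⟨θ, hθ, hθK, hθe, hxθ⟩ := adm_param hT hadm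
  have hxT : x T ∈ XT := hadm.2.2.2.1
  have hK := Kcompact hX m T
  set ν : Measure ℝ := volume.restrict (Icc 0 T) with hν
  have hπ : Measurable (fun z : ℝ × (Fin n → ℝ) × (Fin m → ℝ) => (z.1, z.2.1)) := by fun_prop
  set ρ : ℝ → ℝ × (Fin n → ℝ) := fun t => ((θ t).1, (θ t).2.1) with hρdef
  have hρ : Measurable ρ := hπ.comp hθ
  have hρK : ∀ t, ρ t ∈ Icc (0 : ℝ) T ×ˢ X := fun t => ⟨(hθK t).1, (hθK t).2.1⟩
  set dp : Fin m → ℝ → NNReal := fun j t => ((1 + (θ t).2.2 j) / 2).toNNReal with hdp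
  set dm : Fin m → ℝ → NNReal := fun j t => ((1 - (θ t).2.2 j) / 2).toNNReal with hdm
  have hθj : ∀ j, Measurable (fun t => (θ t).2.2 j) := fun j => by fun_prop
  have hdpm : ∀ j, Measurable (dp j) := fun j => (((hθj j).const_add 1).div_const 2).real_toNNReal
  have hdmm : ∀ j, Measurable (dm j) := fun j => (((hθj j).const_sub 1).div_const 2).real_toNNReal
  have hu1 : ∀ j t, -1 ≤ (θ t).2.2 j ∧ (θ t).2.2 j ≤ 1 := fun j t =>
    ⟨(hθK t).2.2.1 j, (hθK t).2.2.2 j⟩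
  have hdpr : ∀ j t, (dp j t : ℝ) = (1 + (θ t).2.2 j) / 2 := fun j t =>
    Real.coe_toNNReal _ (by linarith [(hu1 j t).1])
  have hdmr : ∀ j t, (dm j t : ℝ) = (1 - (θ t).2.2 j) / 2 := fun j t =>
    Real.coe_toNNReal _ (by linarith [(hu1 j t).2])
  have hsum : ∀ j, ν.withDensity (fun t => (dp j t : ENNReal)) +
      ν.withDensity (fun t => (dm j t : ENNReal)) = ν := by
    intro j
    rw [← withDensity_add_left (hdpm j).coe_nnreal_ennreal]
    have : ((fun t => (dp j t : ENNReal)) + fun t => (dm j t : ENNReal)) = 1 := by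
      funext t
      simp only [Pi.add_apply, Pi.one_apply]
      rw [← ENNReal.coe_add, ENNReal.coe_eq_one]
      apply NNReal.coe_injective
      rw [NNReal.coe_add, hdpr, hdmr, NNReal.coe_one]
      ring
    rw [this, withDensity_one]
  have hsm : ∀ j, (ν.withDensity (fun t => (dp j t : ENNReal))).map ρ +
      (ν.withDensity (fun t => (dm j t : ENNReal))).map ρ = ν.map ρ := by
    intro j
    rw [← Measure.map_add _ _ hρ, hsum]
  have hXc : MeasurableSet (Icc (0 : ℝ) T ×ˢ X) :=
    measurableSet_Icc.prod hX.isClosed.measurableSet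
  have hnull : ∀ τ : Measure ℝ, (τ.map ρ) (Icc (0 : ℝ) T ×ˢ X)ᶜ = 0 := by
    intro τ
    rw [Measure.map_apply hρ hXc.compl]
    have : ρ ⁻¹' (Icc (0 : ℝ) T ×ˢ X)ᶜ = ∅ := by
      ext t
      simpa only [mem_preimage, mem_compl_iff, mem_empty_iff_false, iff_false, not_not] using hρK t
    rw [this, measure_empty]
  have hνf : IsFiniteMeasure ν := ⟨by simp [hν]⟩
  have hpf : ∀ j, IsFiniteMeasure (ν.withDensity (fun t => (dp j t : ENNReal))) := fun j =>
    isFiniteMeasure_of_le ν (by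
      conv_rhs => rw [← hsum j]
      exact Measure.le_add_right le_rfl)
  have hmf : ∀ j, IsFiniteMeasure (ν.withDensity (fun t => (dm j t : ENNReal))) := fun j =>
    isFiniteMeasure_of_le ν (by
      conv_rhs => rw [← hsum j]
      exact Measure.le_add_left le_rfl)
  have hLi : ∀ {φ : ℝ × (Fin n → ℝ) × (Fin m → ℝ) → ℝ}, Continuous φ →
      ∫ z, φ z ∂(ν.map θ) = ∫ t, φ (θ t) ∂ν := fun hφ =>
    integral_map hθ.aemeasurable hφ.aestronglyMeasurable
  have hLρ : ∀ (τ : Measure ℝ) {φ : ℝ × (Fin n → ℝ) → ℝ}, Continuous φ →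
      ∫ z, φ z ∂(τ.map ρ) = ∫ t, φ (ρ t) ∂τ := fun τ φ hφ =>
    integral_map hρ.aemeasurable hφ.aestronglyMeasurable
  have hIntgθ : ∀ {φ : ℝ × (Fin n → ℝ) × (Fin m → ℝ) → ℝ}, Continuous φ →
      Integrable (fun t => φ (θ t)) ν := by
    intro φ hφ
    have := ii_comp hK hφ hθ hθK 0 T
    rwa [intervalIntegrable_iff_integrableOn_Icc_of_le hT.le] at this
  refine ⟨ν.map θ, Measure.dirac (x T), ν.map ρ,
    fun j => (ν.withDensity (fun t => (dp j t : ENNReal))).map ρ,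
    fun j => (ν.withDensity (fun t => (dm j t : ENNReal))).map ρ, fun _ => 0,
    ⟨inferInstance, inferInstance, inferInstance, fun j => ⟨?_, ?_, inferInstance⟩, ?_, ?_,
      hnull _, fun j => ⟨hnull _, hnull _, by simp⟩, ?_, ?_, ?_, ?_⟩, ?_⟩
  · have := hpf j; infer_instance
  · have := hmf j; infer_instance
  · rw [Measure.map_apply hθ hK.isClosed.measurableSet.compl]
    have : θ ⁻¹' (Icc (0 : ℝ) T ×ˢ X ×ˢ Ubox m)ᶜ = ∅ := by
      ext t
      simpa only [mem_preimage, mem_compl_iff, mem_empty_iff_false, iff_false, not_not] using hθK t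
    rw [this, measure_empty]
  · rw [Measure.dirac_apply' _ hXT.isClosed.measurableSet.compl]
    simp [hxT]
  · intro v hv
    rw [hLi (LFop_cont hf hg hv), integral_dirac]
    refine liouville_ftc hX hT hf hg hθ hθK (fun t ht => ?_) hxθ hv
    rw [hθe t ht]; exact ⟨rfl, rfl⟩
  · intro v hv
    rw [hLi (LFop_cont hf hg hv), hLρ ν (Lfop_cont hf hv)]
    have e1 : ∀ j, (∫ z, Lgop g v j z ∂((ν.withDensity (fun t => (dp j t : ENNReal))).map ρ) -
        ∫ z, Lgop g v j z ∂((ν.withDensity (fun t => (dm j t : ENNReal))).map ρ))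
        = ∫ t, (θ t).2.2 j * Lgop g v j (ρ t) ∂ν := by
      intro j
      have hgc := Lgop_cont hg hv j
      rw [hLρ _ hgc, hLρ _ hgc, integral_withDensity_eq_integral_smul (hdpm j),
        integral_withDensity_eq_integral_smul (hdmm j)]
      simp only [NNReal.smul_def, hdpr, hdmr, smul_eq_mul]
      rw [← integral_sub]
      · refine integral_congr_ae (Eventually.of_forall fun t => ?_)
        simp only
        ring
      · exact hIntgθ (φ := fun z => (1 + z.2.2 j) / 2 * Lgop g v j (z.1, z.2.1)) (by fun_prop)
      · exact hIntgθ (φ := fun z => (1 - z.2.2 j) / 2 * Lgop g v j (z.1, z.2.1)) (by fun_prop)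
    have hfc := Lfop_cont hf hv
    have hgc := fun j => Lgop_cont hg hv j
    simp only [e1]
    rw [← integral_finsetSum _ fun j _ =>
      hIntgθ (φ := fun z => z.2.2 j * Lgop g v j (z.1, z.2.1)) (by have := hgc j; fun_prop),
      ← integral_add]
    · refine integral_congr_ae (Eventually.of_forall fun t => ?_)
      simp only [LFop_split, hρdef]
    · exact hIntgθ (φ := fun z => Lfop f v (z.1, z.2.1)) (by fun_prop)
    · exact hIntgθ (φ := fun z => ∑ j, z.2.2 j * Lgop g v j (z.1, z.2.1)) (by fun_prop)
  · intro j
    rw [add_zero]; exact hsm j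
  · rw [Measure.map_map hπ hθ]; rfl
  · rw [Jcost, Qcost, hLi hh, integral_dirac]
    congr 1
    refine setIntegral_congr_fun measurableSet_Icc fun s hs => ?_
    simp only [hθe s hs]

end occ

section mainc
open Filter Topology
variable {n m : ℕ} {T : ℝ} {X XT : Set (Fin n → ℝ)} {x₀ : Fin n → ℝ}
    {f : ℝ × (Fin n → ℝ) → Fin n → ℝ} {g : ℝ × (Fin n → ℝ) → Fin n → Fin m → ℝ}

lemma main_ineq (hT : 0 < T) (hX : IsCompact X) (hXT : IsCompact XT) (hXTsub : XT ⊆ X)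
    (hx₀ : x₀ ∈ X) (hf : Continuous f) (hg : Continuous g)
    {h : ℝ × (Fin n → ℝ) × (Fin m → ℝ) → ℝ} {H : (Fin n → ℝ) → ℝ}
    (hh : Continuous h) (hH : Continuous H)
    {xs : ℝ → Fin n → ℝ} {us : ℝ → Fin m → ℝ}
    (hconv : ∀ (t : ℝ) (x : Fin n → ℝ), ConvexOn ℝ univ (fun u : Fin m → ℝ => h (t, x, u)))
    (hleast : IsLeast (JVals T X XT x₀ f g h H) (Jcost T h H xs us))
    (huniq : ∀ (x : ℝ → Fin n → ℝ) (u : ℝ → Fin m → ℝ),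
      IsAdmissiblePair T X XT x₀ f g x u → Jcost T h H x u = Jcost T h H xs us →
      ∀ᵐ t ∂(volume.restrict (Icc (0 : ℝ) T)), x t = xs t ∧ u t = us t)
    (μ : Measure (ℝ × (Fin n → ℝ) × (Fin m → ℝ))) (μT : Measure (Fin n → ℝ))
    [IsFiniteMeasure μ] [IsFiniteMeasure μT]
    (hμ : μ ((Icc (0 : ℝ) T ×ˢ X ×ˢ Ubox m)ᶜ) = 0) (hμT : μT (XTᶜ) = 0)
    (hL : SatisfiesLiouville T x₀ f g μ μT)
    (hQ : Qcost h H μ μT ≤ Jcost T h H xs us)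
    {ψ : ℝ × (Fin n → ℝ) → ℝ} (hψ : Continuous ψ) :
    ∫ t in Icc 0 T, ψ (t, xs t) ≤ ∫ z, ψ (z.1, z.2.1) ∂μ := by
  have hK := Kcompact hX m T
  have hG : Continuous (Fvec f g) := Fvec_cont hf hg
  set I : ℝ := ∫ z, ψ (z.1, z.2.1) ∂μ with hI
  set φ : ℝ × (Fin n → ℝ) × (Fin m → ℝ) → ℝ := fun z => ψ (z.1, z.2.1) with hφdef
  have hφ : Continuous φ := by fun_prop
  obtain ⟨C, hC⟩ := exists_nnbound hK hφ
  obtain ⟨Ch, hCh⟩ := exists_nnbound hK hh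
  set ε : ℕ → ℝ := fun k => 1 / ((k : ℝ) + 1) with hεdef
  have hε : ∀ k, 0 < ε k := fun k => by positivity
  have hεlim : Tendsto ε atTop (𝓝 0) := tendsto_one_div_add_atTop_nhds_zero_nat
  have hex : ∀ k, ∃ (x : ℝ → Fin n → ℝ) (u : ℝ → Fin m → ℝ)
      (θ : ℝ → ℝ × (Fin n → ℝ) × (Fin m → ℝ)), x T ∈ XT ∧ Measurable θ ∧
      (∀ s, θ s ∈ Icc (0 : ℝ) T ×ˢ X ×ˢ Ubox m) ∧ (∀ t ∈ Icc 0 T, θ t = (t, x t, u t)) ∧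
      (∀ t ∈ Icc 0 T, x t = x₀ + ∫ s in (0 : ℝ)..t, Fvec f g (θ s)) ∧
      (∫ s in (0 : ℝ)..T, φ (θ s)) ≤ I ∧
      (∫ s in (0 : ℝ)..T, h (θ s)) + H (x T) ≤ Jcost T h H xs us + (I + C * T) * ε k := by
    intro k
    set hk : ℝ × (Fin n → ℝ) × (Fin m → ℝ) → ℝ := fun z => h z + ε k * φ z with hkdef
    have hkc : Continuous hk := by fun_prop
    have hkconv : ∀ t x, ConvexOn ℝ univ (fun u => hk (t, x, u)) := fun t x =>
      (hconv t x).add_const (ε k * ψ (t, x))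
    obtain ⟨x, u, hadm, hJ⟩ := nogap hX hXT hXTsub hT hx₀ hf hg hkc hH hkconv μ μT hμ hμT hL
    obtain ⟨θ, hθ, hθK, hθe, hxθ⟩ := adm_param hT hadm
    have hlow : Jcost T h H xs us ≤ Jcost T h H x u := hleast.2 ⟨x, u, hadm, rfl⟩
    have hQk : Qcost hk H μ μT = Qcost h H μ μT + ε k * I := by
      simp only [Qcost, hkdef]
      rw [integral_add (integrable_of_cont hK μ hμ hh)
        ((integrable_of_cont hK μ hμ hφ).const_mul _), integral_const_mul]
      ring
    have hJk : Jcost T hk H x u = (∫ s in (0 : ℝ)..T, h (θ s)) +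
        ε k * (∫ s in (0 : ℝ)..T, φ (θ s)) + H (x T) := by
      rw [Jcost, ← param_integral hT hθe]
      simp only [hkdef]
      rw [intervalIntegral.integral_add (ii_comp hK hh hθ hθK _ _)
        ((ii_comp hK hφ hθ hθK _ _).const_mul _), intervalIntegral.integral_const_mul]
    have hJ0 : Jcost T h H x u = (∫ s in (0 : ℝ)..T, h (θ s)) + H (x T) := by
      rw [Jcost, ← param_integral hT hθe]
    rw [hQk, hJk] at hJ
    have hle : ε k * (∫ s in (0 : ℝ)..T, φ (θ s)) ≤ ε k * I := by linarith
    have hb := (neg_abs_le _).trans' (neg_le_neg (norm_II_le hθK hC 0 T))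
    rw [sub_zero, abs_of_pos hT] at hb
    have hb2 := mul_le_mul_of_nonneg_left hb (hε k).le
    refine ⟨x, u, θ, hadm.2.2.2.1, hθ, hθK, hθe, hxθ, le_of_mul_le_mul_left hle (hε k), ?_⟩
    nlinarith
  choose x u θ hxT hθ hθK hθe hxθ hφI hcost using hex
  set l : Ultrafilter ℕ := Filter.hyperfilter ℕ with hl
  have hlat : (l : Filter ℕ) ≤ atTop := Nat.hyperfilter_le_atTop
  have hεl : Tendsto ε l (𝓝 0) := hεlim.mono_left hlat
  have hend : Tendsto (fun k => dist (x k T) (x₀ + ∫ s in (0 : ℝ)..T, Fvec f g (θ k s))) l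
      (𝓝 0) := by
    refine tendsto_const_nhds.congr fun k => ?_
    rw [← hxθ k T ⟨hT.le, le_rfl⟩, dist_self]
  have htr : ∀ δ > 0, ∀ᶠ k in (l : Filter ℕ), ∀ s ∈ Ioo δ (T - δ),
      dist (θ k s).1 s ≤ δ ∧
        dist (θ k s).2.1 (x₀ + ∫ r in (0 : ℝ)..s, Fvec f g (θ k r)) ≤ δ := by
    intro δ hδ
    refine Eventually.of_forall fun k s hs => ?_
    have hsI : s ∈ Icc 0 T := ⟨by linarith [hs.1], by linarith [hs.2]⟩
    rw [← hxθ k s hsI, hθe k s hsI]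
    simp [hδ.le]
  obtain ⟨x', u', hadm, hxlim, hlow⟩ := closure_lemma hX hXT hXTsub hT hx₀ hG (fun _ _ => rfl)
    (Fvec_conv f g) l hθ hθK (fun _ => x₀) tendsto_const_nhds (fun k => x k T) hxT hend htr
  obtain ⟨c, hc⟩ := ultra_lim l (fun k => ∫ s in (0 : ℝ)..T, h (θ k s)) _
    (fun k => norm_II_le (hθK k) hCh 0 T)
  obtain ⟨d, hd⟩ := ultra_lim l (fun k => ∫ s in (0 : ℝ)..T, φ (θ k s)) _
    (fun k => norm_II_le (hθK k) hC 0 T)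
  have h1 := hlow h hh hconv c hc
  have h2 := hlow φ hφ (fun t x => convexOn_const (ψ (t, x)) convex_univ) d hd
  have hdI : d ≤ I := le_of_tendsto hd (Eventually.of_forall hφI)
  have hHlim : Tendsto (fun k => H (x k T)) l (𝓝 (H (x' T))) := (hH.tendsto _).comp hxlim
  have hfin : c + H (x' T) ≤ Jcost T h H xs us + (I + C * T) * 0 :=
    le_of_tendsto_of_tendsto (hc.add hHlim) ((hεl.const_mul _).const_add _)
      (Eventually.of_forall hcost)
  have hJle : Jcost T h H x' u' ≤ Jcost T h H xs us := by
    unfold Jcost at hfin ⊢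
    linarith
  have hJeq := le_antisymm hJle (hleast.2 ⟨x', u', hadm, rfl⟩)
  have hae := huniq x' u' hadm hJeq
  have e : ∫ t in Icc 0 T, ψ (t, xs t) = ∫ s in Icc 0 T, φ (s, x' s, u' s) := by
    refine integral_congr_ae ?_
    filter_upwards [hae] with t ht
    simp only [hφdef, ht.1]
  rw [e]
  exact h2.trans hdI

lemma main_cont (hT : 0 < T) (hX : IsCompact X) (hXT : IsCompact XT) (hXTsub : XT ⊆ X)
    (hx₀ : x₀ ∈ X) (hf : Continuous f) (hg : Continuous g)
    {h : ℝ × (Fin n → ℝ) × (Fin m → ℝ) → ℝ} {H : (Fin n → ℝ) → ℝ}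
    (hh : Continuous h) (hH : Continuous H)
    {xs : ℝ → Fin n → ℝ} {us : ℝ → Fin m → ℝ}
    (hconv : ∀ (t : ℝ) (x : Fin n → ℝ), ConvexOn ℝ univ (fun u : Fin m → ℝ => h (t, x, u)))
    (hopt : IsAdmissiblePair T X XT x₀ f g xs us)
    (hleast : IsLeast (JVals T X XT x₀ f g h H) (Jcost T h H xs us))
    (huniq : ∀ (x : ℝ → Fin n → ℝ) (u : ℝ → Fin m → ℝ),
      IsAdmissiblePair T X XT x₀ f g x u → Jcost T h H x u = Jcost T h H xs us →
      ∀ᵐ t ∂(volume.restrict (Icc (0 : ℝ) T)), x t = xs t ∧ u t = us t)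
    {μ : Measure (ℝ × (Fin n → ℝ) × (Fin m → ℝ))} {μT : Measure (Fin n → ℝ)}
    {γ : Measure (ℝ × (Fin n → ℝ))} {σp σm σh : Fin m → Measure (ℝ × (Fin n → ℝ))}
    (hfeas : PFeasible T X XT x₀ f g μ μT γ σp σm σh)
    (hmin : IsLeast (PVals T X XT x₀ f g h H) (Qcost h H μ μT)) :
    γ = Measure.map (fun t => (t, xs t)) (volume.restrict (Icc (0 : ℝ) T)) := by
  obtain ⟨i1, i2, i3, -, hμ, hμT, -, -, hL, -, -, hγ⟩ := hfeas
  have hQ := hmin.2 (occ_feasible hX hXT hT hf hg hh hopt)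
  have hxc := adm_continuousOn hopt
  have hmeas : AEMeasurable (fun t => (t, xs t)) (volume.restrict (Icc (0 : ℝ) T)) :=
    aemeasurable_id.prodMk (hxc.aemeasurable measurableSet_Icc)
  have hfin : IsFiniteMeasure (volume.restrict (Icc (0 : ℝ) T)) := ⟨by simp⟩
  refine ext_of_forall_integral_eq_of_IsFiniteMeasure fun ψ => ?_
  have hπ : Measurable (fun z : ℝ × (Fin n → ℝ) × (Fin m → ℝ) => (z.1, z.2.1)) := by fun_prop
  rw [integral_map hmeas ψ.continuous.aestronglyMeasurable, hγ,
    integral_map hπ.aemeasurable ψ.continuous.aestronglyMeasurable]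
  have hpos := main_ineq hT hX hXT hXTsub hx₀ hf hg hh hH hconv hleast huniq μ μT hμ hμT hL hQ
    ψ.continuous
  have hneg := main_ineq hT hX hXT hXTsub hx₀ hf hg hh hH hconv hleast huniq μ μT hμ hμT hL hQ
    ψ.continuous.neg
  simp only [Pi.neg_apply, integral_neg] at hneg
  exact le_antisymm (neg_le_neg_iff.1 hneg) hpos

lemma adm_congr {f' : ℝ × (Fin n → ℝ) → Fin n → ℝ} {g' : ℝ × (Fin n → ℝ) → Fin n → Fin m → ℝ}
    (hff : ∀ z : ℝ × (Fin n → ℝ), z.1 ∈ Icc 0 T → f z = f' z)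
    (hgg : ∀ z : ℝ × (Fin n → ℝ), z.1 ∈ Icc 0 T → g z = g' z)
    {x : ℝ → Fin n → ℝ} {u : ℝ → Fin m → ℝ} (hadm : IsAdmissiblePair T X XT x₀ f g x u) :
    IsAdmissiblePair T X XT x₀ f' g' x u := by
  obtain ⟨hu, huU, h0, hxT, hxX, hIntg, hode⟩ := hadm
  have e : ∀ s ∈ Icc 0 T, Fvec f g (s, x s, u s) = Fvec f' g' (s, x s, u s) := fun s hs => by
    unfold Fvec
    rw [hff _ hs, hgg _ hs]
  refine ⟨hu, huU, h0, hxT, hxX, hIntg.congr_fun e measurableSet_Icc, fun t ht => ?_⟩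
  rw [hode t ht]
  congr 1
  exact setIntegral_congr_fun measurableSet_Icc fun s hs => e s ⟨hs.1, hs.2.trans ht.2⟩

lemma feas_congr {f' : ℝ × (Fin n → ℝ) → Fin n → ℝ} {g' : ℝ × (Fin n → ℝ) → Fin n → Fin m → ℝ}
    (hff : ∀ z : ℝ × (Fin n → ℝ), z.1 ∈ Icc 0 T → f z = f' z)
    (hgg : ∀ z : ℝ × (Fin n → ℝ), z.1 ∈ Icc 0 T → g z = g' z)
    {μ : Measure (ℝ × (Fin n → ℝ) × (Fin m → ℝ))} {μT : Measure (Fin n → ℝ)}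
    {γ : Measure (ℝ × (Fin n → ℝ))} {σp σm σh : Fin m → Measure (ℝ × (Fin n → ℝ))}
    (hfeas : PFeasible T X XT x₀ f g μ μT γ σp σm σh) :
    PFeasible T X XT x₀ f' g' μ μT γ σp σm σh := by
  obtain ⟨i1, i2, i3, i4, hμ, hμT, hγn, hσ, hL, hb, hcc, hd⟩ := hfeas
  have eF : ∀ v, ∫ z, LFop f g v z ∂μ = ∫ z, LFop f' g' v z ∂μ := fun v => by
    refine integral_congr_ae ?_
    have hm : ∀ᵐ z ∂μ, z ∈ Icc (0 : ℝ) T ×ˢ X ×ˢ Ubox m := hμ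
    filter_upwards [hm] with z hz
    unfold LFop Fvec
    rw [hff _ hz.1, hgg _ hz.1]
  have ef : ∀ v, ∫ z, Lfop f v z ∂γ = ∫ z, Lfop f' v z ∂γ := fun v => by
    refine integral_congr_ae ?_
    have hm : ∀ᵐ z ∂γ, z ∈ Icc (0 : ℝ) T ×ˢ X := hγn
    filter_upwards [hm] with z hz
    unfold Lfop
    rw [hff _ hz.1]
  have eg : ∀ (τ : Measure (ℝ × (Fin n → ℝ))) (_ : τ ((Icc (0 : ℝ) T ×ˢ X)ᶜ) = 0) v j,
      ∫ z, Lgop g v j z ∂τ = ∫ z, Lgop g' v j z ∂τ := fun τ hτ v j => by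
    refine integral_congr_ae ?_
    have hm : ∀ᵐ z ∂τ, z ∈ Icc (0 : ℝ) T ×ˢ X := hτ
    filter_upwards [hm] with z hz
    unfold Lgop
    rw [hgg _ hz.1]
  refine ⟨i1, i2, i3, i4, hμ, hμT, hγn, hσ, fun v hv => ?_, fun v hv => ?_, hcc, hd⟩
  · rw [← eF]; exact hL v hv
  · rw [← eF, ← ef, hb v hv]
    congr 1
    refine Finset.sum_congr rfl fun j _ => ?_
    rw [eg _ (hσ j).1, eg _ (hσ j).2.1]

end mainc

/-- if (P) is feasible and Γ* = (μ*, μ_T*, γ*, σ₊*, σ₋*, σ̂*) is a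
minimizer of (P), then γ* is the occupation measure of the optimal trajectory x*:
the pushforward of Lebesgue measure on [0,T] under t ↦ (t, x*(t)). -/
theorem P_optimal_gamma_is_occupation
    {n m : ℕ} (hn : 0 < n) (hm : 0 < m) (T : ℝ) (hT : 0 < T)
    (X XT : Set (Fin n → ℝ)) (hX : IsCompact X) (hXT : IsCompact XT) (hXTsub : XT ⊆ X)
    (x₀ : Fin n → ℝ) (hx₀ : x₀ ∈ X)
    (f : ℝ × (Fin n → ℝ) → Fin n → ℝ) (g : ℝ × (Fin n → ℝ) → Fin n → Fin m → ℝ)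
    (hf : ContinuousOn f (Set.Icc (0 : ℝ) T ×ˢ Set.univ))
    (hg : ContinuousOn g (Set.Icc (0 : ℝ) T ×ˢ Set.univ))
    (h : ℝ × (Fin n → ℝ) × (Fin m → ℝ) → ℝ) (H : (Fin n → ℝ) → ℝ)
    (hh : Continuous h) (hH : Continuous H)
    (xs : ℝ → Fin n → ℝ) (us : ℝ → Fin m → ℝ)
    (hconv : ∀ (t : ℝ) (x : Fin n → ℝ),
      ConvexOn ℝ Set.univ (fun u : Fin m → ℝ => h (t, x, u)))
    (hopt : IsAdmissiblePair T X XT x₀ f g xs us)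
    (hleast : IsLeast (JVals T X XT x₀ f g h H) (Jcost T h H xs us))
    (huniq : ∀ (x : ℝ → Fin n → ℝ) (u : ℝ → Fin m → ℝ),
      IsAdmissiblePair T X XT x₀ f g x u → Jcost T h H x u = Jcost T h H xs us →
      ∀ᵐ t ∂(volume.restrict (Set.Icc (0 : ℝ) T)), x t = xs t ∧ u t = us t)
    (μ : Measure (ℝ × (Fin n → ℝ) × (Fin m → ℝ))) (μT : Measure (Fin n → ℝ))
    (γ : Measure (ℝ × (Fin n → ℝ))) (σp σm σh : Fin m → Measure (ℝ × (Fin n → ℝ)))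
    (hfeas : PFeasible T X XT x₀ f g μ μT γ σp σm σh)
    (hmin : IsLeast (PVals T X XT x₀ f g h H) (Qcost h H μ μT)) :
    γ = Measure.map (fun t => (t, xs t)) (volume.restrict (Set.Icc (0 : ℝ) T)) := by

  set c : ℝ × (Fin n → ℝ) → ℝ × (Fin n → ℝ) := fun z => (max 0 (min T z.1), z.2) with hc
  have hcc : Continuous c := by fun_prop
  have hcI : ∀ z, c z ∈ Icc (0 : ℝ) T ×ˢ (univ : Set (Fin n → ℝ)) := fun z =>
    ⟨⟨le_max_left _ _, max_le hT.le (min_le_left _ _)⟩, mem_univ _⟩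
  have hcid : ∀ z : ℝ × (Fin n → ℝ), z.1 ∈ Icc 0 T → c z = z := fun z hz => by
    simp only [hc]; rw [min_eq_right hz.2, max_eq_right hz.1]
  have hft : Continuous (f ∘ c) := hf.comp_continuous hcc hcI
  have hgt : Continuous (g ∘ c) := hg.comp_continuous hcc hcI
  have hff : ∀ z : ℝ × (Fin n → ℝ), z.1 ∈ Icc 0 T → f z = (f ∘ c) z := fun z hz => by
    rw [Function.comp, hcid z hz]
  have hgg : ∀ z : ℝ × (Fin n → ℝ), z.1 ∈ Icc 0 T → g z = (g ∘ c) z := fun z hz => by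
    rw [Function.comp, hcid z hz]
  have hff' : ∀ z : ℝ × (Fin n → ℝ), z.1 ∈ Icc 0 T → (f ∘ c) z = f z := fun z hz => (hff z hz).symm
  have hgg' : ∀ z : ℝ × (Fin n → ℝ), z.1 ∈ Icc 0 T → (g ∘ c) z = g z := fun z hz => (hgg z hz).symm
  refine main_cont hT hX hXT hXTsub hx₀ hft hgt hh hH hconv (adm_congr hff hgg hopt)
    ⟨⟨xs, us, adm_congr hff hgg hopt, rfl⟩, ?_⟩
    (fun x u hadm hJ => huniq x u (adm_congr hff' hgg' hadm) hJ) (feas_congr hff hgg hfeas)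
    ⟨⟨μ, μT, γ, σp, σm, σh, feas_congr hff hgg hfeas, rfl⟩, ?_⟩
  · rintro _ ⟨x, u, hadm, rfl⟩
    exact hleast.2 ⟨x, u, adm_congr hff' hgg' hadm, rfl⟩
  · rintro _ ⟨μ', μT', γ', σp', σm', σh', hfe, rfl⟩
    exact hmin.2 ⟨μ', μT', γ', σp', σm', σh', feas_congr hff' hgg' hfe, rfl⟩

end
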